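/- arXiv:1406.4368 — 2 statements merged into one kernel-verified Lean document; each statement's English description precedes it below -/
import Mathlib

section
/- Let f be an endomorphism of A₁ with P = f(X) and Q = f(Y). If there exists an involution E on A₁, conjugate to α, such that at least one of the following holds: E(P) = P, or E(P) = −P, or E(Q) = Q, or E(Q) = −Q (i.e., P or Q is symmetric or skew-symmetric with respect to E), then f is an automorphism of A₁. -/
noncomputable section

/-- `f : A → A` is a `K`-algebra endomorphism (as a bare function). -/
def IsAlgEndo (K : Type) [CommSemiring K] {A : Type} [Semiring A] [Algebra K A]
    (f : A → A) : Prop :=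
  (∀ a b : A, f (a + b) = f a + f b) ∧
  (∀ (c : K) (a : A), f (c • a) = c • f a) ∧
  (∀ a b : A, f (a * b) = f a * f b) ∧ f 1 = 1

/-- `f : A → A` is a `K`-algebra automorphism: a bijective endomorphism. -/
def IsAlgAuto (K : Type) [CommSemiring K] {A : Type} [Semiring A] [Algebra K A]
    (f : A → A) : Prop :=
  IsAlgEndo K f ∧ Function.Bijective f

/-- `f : A → A` is a `K`-linear anti-endomorphism. -/
def IsAntiEndo (K : Type) [CommSemiring K] {A : Type} [Semiring A] [Algebra K A]
    (f : A → A) : Prop :=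
  (∀ a b : A, f (a + b) = f a + f b) ∧
  (∀ (c : K) (a : A), f (c • a) = c • f a) ∧
  (∀ a b : A, f (a * b) = f b * f a) ∧ f 1 = 1

/-- `f : A → A` is an anti-automorphism: a bijective anti-endomorphism. -/
def IsAntiAuto (K : Type) [CommSemiring K] {A : Type} [Semiring A] [Algebra K A]
    (f : A → A) : Prop :=
  IsAntiEndo K f ∧ Function.Bijective f

/-- An involution on a `K`-algebra: an anti-automorphism of order at most two. -/
def IsInvolutionOn (K : Type) [CommSemiring K] {A : Type} [Semiring A] [Algebra K A]
    (γ : A → A) : Prop :=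
  IsAntiAuto K γ ∧ γ ∘ γ = id

/-- The defining relation of the first Weyl algebra: `Y*X = X*Y + 1`. -/
inductive WeylRel (K : Type) [CommSemiring K] :
    FreeAlgebra K (Fin 2) → FreeAlgebra K (Fin 2) → Prop
  | rel : WeylRel K (FreeAlgebra.ι K 1 * FreeAlgebra.ι K 0)
      (FreeAlgebra.ι K 0 * FreeAlgebra.ι K 1 + 1)

/-- The first Weyl algebra `A₁(K) = K⟨X,Y⟩/(YX - XY - 1)`. -/
abbrev Weyl (K : Type) [CommSemiring K] : Type := RingQuot (WeylRel K)

/-- The generator `X` of the Weyl algebra. -/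
def Wx (K : Type) [CommSemiring K] : Weyl K :=
  RingQuot.mkAlgHom K (WeylRel K) (FreeAlgebra.ι K 0)

/-- The generator `Y` of the Weyl algebra. -/
def Wy (K : Type) [CommSemiring K] : Weyl K :=
  RingQuot.mkAlgHom K (WeylRel K) (FreeAlgebra.ι K 1)

/-- `α` is the exchange involution: the involution with `α X = Y` and `α Y = X`. -/
def IsExchange (K : Type) [CommSemiring K] (α : Weyl K → Weyl K) : Prop :=
  IsInvolutionOn K α ∧ α (Wx K) = Wy K ∧ α (Wy K) = Wx K

/-- `γ` is conjugate to `α` by an automorphism or an anti-automorphism: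
`γ = g⁻¹ ∘ α ∘ g`. -/
def ConjToAlpha (K : Type) [CommSemiring K] (α γ : Weyl K → Weyl K) : Prop :=
  ∃ g : Weyl K → Weyl K, (IsAlgAuto K g ∨ IsAntiAuto K g) ∧
    γ = Function.invFun g ∘ α ∘ g

set_option linter.unusedSimpArgs false
set_option linter.unusedSectionVars false
set_option linter.style.haveILetI false
set_option linter.deprecated false


namespace WA
section
open MvPolynomial

variable {R : Type} [CommRing R]

/-- universal property -/
def lft {A : Type*} [Semiring A] [Algebra R A] (a b : A) (h : b * a = a * b + 1) :
    Weyl R →ₐ[R] A :=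
  RingQuot.liftAlgHom R ⟨FreeAlgebra.lift R ![a, b], by rintro _ _ ⟨⟩; simp [h]⟩

@[simp] lemma lft_x {A : Type*} [Semiring A] [Algebra R A] (a b : A) (h : b * a = a * b + 1) :
    lft (R := R) a b h (Wx R) = a := by
  simp [lft, Wx, RingQuot.liftAlgHom_mkAlgHom_apply]

@[simp] lemma lft_y {A : Type*} [Semiring A] [Algebra R A] (a b : A) (h : b * a = a * b + 1) :
    lft (R := R) a b h (Wy R) = b := by
  simp [lft, Wy, RingQuot.liftAlgHom_mkAlgHom_apply]

lemma yx : Wy R * Wx R = Wx R * Wy R + 1 := by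
  have := RingQuot.mkAlgHom_rel R (WeylRel.rel (K := R))
  simpa [Wx, Wy] using this

lemma hom_ext {A : Type*} [Semiring A] [Algebra R A] {f g : Weyl R →ₐ[R] A}
    (hx : f (Wx R) = g (Wx R)) (hy : f (Wy R) = g (Wy R)) : f = g := by
  apply RingQuot.ringQuot_ext'
  apply FreeAlgebra.hom_ext
  funext i
  fin_cases i
  · simpa [Wx] using hx
  · simpa [Wy] using hy

lemma adj : Algebra.adjoin R {Wx R, Wy R} = ⊤ := by
  set S := Algebra.adjoin R {Wx R, Wy R}
  have hx : Wx R ∈ S := Algebra.subset_adjoin (by simp)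
  have hy : Wy R ∈ S := Algebra.subset_adjoin (by simp)
  let f : Weyl R →ₐ[R] S := lft ⟨_, hx⟩ ⟨_, hy⟩ (by ext; simpa using yx)
  have h : S.val.comp f = AlgHom.id R _ := hom_ext (by simp [f]) (by simp [f])
  rw [eq_top_iff]
  intro w _
  have := congrArg (fun g => g w) h
  simp only [AlgHom.comp_apply, AlgHom.id_apply] at this
  rw [← this]
  exact (f w).2

abbrev M (R : Type) [CommRing R] := MvPolynomial (Fin 2) R

lemma ind {p : Weyl R → Prop} (hx : p (Wx R)) (hy : p (Wy R)) (hc : ∀ r : R, p (algebraMap R _ r))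
    (ha : ∀ a b, p a → p b → p (a + b)) (hm : ∀ a b, p a → p b → p (a * b)) (w : Weyl R) : p w := by
  have hw : w ∈ Algebra.adjoin R {Wx R, Wy R} := by rw [adj]; trivial
  induction hw using Algebra.adjoin_induction with
  | mem x hx' =>
    rcases hx' with rfl | rfl
    · exact hx
    · exact hy
  | algebraMap r => exact hc r
  | add x y _ _ h1 h2 => exact ha _ _ h1 h2
  | mul x y _ _ h1 h2 => exact hm _ _ h1 h2

def ou : Module.End R (M R) := LinearMap.mulLeft R (X 0)
def ov : Module.End R (M R) := (pderiv (R := R) (0 : Fin 2)).toLinearMap + LinearMap.mulLeft R (X 1)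

@[simp] lemma ou_apply (m : M R) : ou m = X 0 * m := rfl
@[simp] lemma ov_apply (m : M R) : ov m = pderiv 0 m + X 1 * m := rfl

def rho : Weyl R →ₐ[R] Module.End R (M R) := lft ou ov (by
  ext1 m
  ext1
  simp [pderiv_mul, pderiv_X_self]
  ring)

@[simp] lemma rho_x : rho (Wx R) = ou := by simp [rho]
@[simp] lemma rho_y : rho (Wy R) = ov := by simp [rho]

def sym : Weyl R →ₗ[R] M R where
  toFun w := rho w 1
  map_add' a b := by simp
  map_smul' r a := by simp

lemma sym_def (w : Weyl R) : sym w = rho w 1 := rfl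

lemma sym_mul (a b : Weyl R) : sym (a * b) = rho a (sym b) := by simp [sym_def]

@[simp] lemma sym_one : sym (1 : Weyl R) = 1 := by simp [sym_def]

lemma sym_x_mul (w : Weyl R) : sym (Wx R * w) = X 0 * sym w := by simp [sym_mul]
lemma sym_y_mul (w : Weyl R) : sym (Wy R * w) = pderiv 0 (sym w) + X 1 * sym w := by simp [sym_mul]

lemma rho_comm_op (T : Module.End R (M R)) (h0 : ou * T = T * ou) (h1 : ov * T = T * ov)
    (w : Weyl R) : rho w * T = T * rho w := by
  induction w using ind with
  | hx => simpa using h0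
  | hy => simpa using h1
  | hc r => rw [AlgHom.commutes]; exact Algebra.commutes r T
  | ha a b h1 h2 => rw [map_add, add_mul, mul_add, h1, h2]
  | hm a b h1 h2 => rw [map_mul, mul_assoc, h2, ← mul_assoc, h1, mul_assoc]

lemma sym_mul_y (w : Weyl R) : sym (w * Wy R) = X 1 * sym w := by
  have := rho_comm_op (LinearMap.mulLeft R (X 1 : M R)) (by ext1 m; ext1; simp; ring)
    (by ext1 m; ext1; simp [pderiv_mul, pderiv_X_of_ne]; ring) w
  have := congrArg (fun T => T 1) this
  simpa [sym_mul, sym_def] using this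

lemma pderiv_comm (i j : Fin 2) (m : M R) : pderiv i (pderiv j m) = pderiv j (pderiv i m) := by
  have : ⁅pderiv (R := R) i, pderiv (R := R) j⁆ = 0 := by
    apply MvPolynomial.derivation_ext
    intro k
    simp [Derivation.commutator_apply, pderiv_X, Pi.single_apply]
    split_ifs <;> simp
  have := congrArg (fun T => T m) this
  simpa [Derivation.commutator_apply, sub_eq_zero] using this

lemma sym_mul_x (w : Weyl R) : sym (w * Wx R) = X 0 * sym w + pderiv 1 (sym w) := by
  have := rho_comm_op (LinearMap.mulLeft R (X 0 : M R) + (pderiv (R := R) (1 : Fin 2)).toLinearMap)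
    (by ext1 m; ext1; simp [pderiv_mul, pderiv_X_of_ne]; ring)
    (by ext1 m; ext1; simp [pderiv_mul, pderiv_X_of_ne, pderiv_X_self, pderiv_comm 1 0]; ring) w
  have := congrArg (fun T => T 1) this
  simpa [sym_mul, sym_def, ou] using this

lemma sym_ady (w : Weyl R) : sym (Wy R * w - w * Wy R) = pderiv 0 (sym w) := by
  rw [map_sub, sym_y_mul, sym_mul_y]; ring

lemma sym_adx (w : Weyl R) : sym (w * Wx R - Wx R * w) = pderiv 1 (sym w) := by
  rw [map_sub, sym_x_mul, sym_mul_x]; ring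

/-- normal ordering -/
def nf : M R →ₗ[R] Weyl R :=
  (basisMonomials (Fin 2) R).constr R (fun s => Wx R ^ s 0 * Wy R ^ s 1)

lemma nf_mon (s : Fin 2 →₀ ℕ) (r : R) : nf (monomial s r) = r • (Wx R ^ s 0 * Wy R ^ s 1) := by
  have : monomial s r = r • basisMonomials (Fin 2) R s := by simp [smul_monomial]
  rw [this, map_smul, nf, Module.Basis.constr_basis]

@[simp] lemma nf_one : nf (1 : M R) = 1 := by
  have := nf_mon (R := R) 0 1
  simpa using this

lemma y_mul_xpow (n : ℕ) : Wy R * Wx R ^ n = Wx R ^ n * Wy R + (n : Weyl R) * Wx R ^ (n - 1) := by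
  induction n with
  | zero => simp
  | succ n ih =>
    rw [pow_succ, ← mul_assoc, ih, add_mul, mul_assoc, yx, Nat.add_sub_cancel]
    rcases n with _ | n
    · simp
    · simp only [Nat.add_sub_cancel]; rw [mul_assoc, ← pow_succ]; push_cast; noncomm_ring

lemma ypow_mul_x (n : ℕ) : Wy R ^ n * Wx R = Wx R * Wy R ^ n + (n : Weyl R) * Wy R ^ (n - 1) := by
  induction n with
  | zero => simp
  | succ n ih =>
    rw [pow_succ', mul_assoc, ih, mul_add, ← mul_assoc, yx, Nat.add_sub_cancel]
    rcases n with _ | n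
    · simp
    · simp only [Nat.add_sub_cancel]
      rw [← mul_assoc, ← Nat.cast_comm, mul_assoc, ← pow_succ']; push_cast; noncomm_ring

lemma nf_rho (w : Weyl R) : ∀ m : M R, nf (rho w m) = w * nf m := by
  induction w using ind with
  | hx =>
    intro m
    induction m using MvPolynomial.induction_on' with
    | monomial s r =>
      have : X 0 * monomial s r = monomial (s + Finsupp.single 0 1) r := by
        rw [mul_comm, X, monomial_mul, mul_one]
      simp [this, nf_mon, pow_succ', mul_assoc]
    | add p q h1 h2 => rw [map_add, map_add, map_add, mul_add, h1, h2]
  | hy =>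
    intro m
    induction m using MvPolynomial.induction_on' with
    | monomial s r =>
      have : X 1 * monomial s r = monomial (s + Finsupp.single 1 1) r := by
        rw [mul_comm, X, monomial_mul, mul_one]
      rw [rho_y, ov_apply, this, pderiv_monomial, map_add, nf_mon, nf_mon, nf_mon, mul_smul_comm,
        ← mul_assoc, y_mul_xpow]
      simp [pow_succ', add_mul, mul_assoc]
      rw [add_comm]
      congr 1
      rw [mul_smul, ← nsmul_eq_mul, ← Nat.cast_smul_eq_nsmul R]
    | add p q h1 h2 => rw [map_add, map_add, map_add, mul_add, h1, h2]
  | hc r => intro m; simp [Algebra.algebraMap_eq_smul_one]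
  | ha a b h1 h2 => intro m; simp [h1, h2, add_mul]
  | hm a b h1 h2 => intro m; simp [h1, h2, mul_assoc]

@[simp] lemma nf_sym (w : Weyl R) : nf (sym w) = w := by
  rw [sym_def, nf_rho, nf_one, mul_one]

lemma sym_ypow (n : ℕ) : sym (Wy R ^ n) = X 1 ^ n := by
  induction n with
  | zero => simp
  | succ n ih => rw [pow_succ, sym_mul_y, ih, pow_succ']

lemma sym_xpow_mul (n : ℕ) (w : Weyl R) : sym (Wx R ^ n * w) = X 0 ^ n * sym w := by
  induction n with
  | zero => simp
  | succ n ih => rw [pow_succ', mul_assoc, sym_x_mul, ih, pow_succ', mul_assoc]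

lemma sym_mon (i j : ℕ) : sym (Wx R ^ i * Wy R ^ j) = X 0 ^ i * X 1 ^ j := by
  rw [sym_xpow_mul, sym_ypow]

@[simp] lemma sym_nf (m : M R) : sym (nf m) = m := by
  induction m using MvPolynomial.induction_on' with
  | monomial s r =>
    rw [nf_mon, map_smul, sym_mon, monomial_eq, Finsupp.prod_fintype _ _ (by simp)]
    simp [smul_eq_C_mul]
  | add p q h1 h2 => rw [map_add, map_add, h1, h2]

lemma sym_inj : Function.Injective (sym (R := R)) := Function.LeftInverse.injective nf_sym

end
end WA


namespace WA
section
open MvPolynomial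

variable {R : Type} [CommRing R]

/-- functoriality -/
def mp {S : Type} [CommRing S] (φ : R →+* S) : Weyl R →+* Weyl S :=
  let _ : Algebra R (Weyl S) := ((algebraMap S (Weyl S)).comp φ).toAlgebra'
    (fun c x => Algebra.commutes (φ c) x)
  (lft (R := R) (Wx S) (Wy S) yx).toRingHom

section
variable {S : Type} [CommRing S] (φ : R →+* S)

@[simp] lemma mp_x : mp φ (Wx R) = Wx S := by
  let _ : Algebra R (Weyl S) := ((algebraMap S (Weyl S)).comp φ).toAlgebra'
    (fun c x => Algebra.commutes (φ c) x)
  exact lft_x (R := R) (Wx S) (Wy S) yx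

@[simp] lemma mp_y : mp φ (Wy R) = Wy S := by
  let _ : Algebra R (Weyl S) := ((algebraMap S (Weyl S)).comp φ).toAlgebra'
    (fun c x => Algebra.commutes (φ c) x)
  exact lft_y (R := R) (Wx S) (Wy S) yx

@[simp] lemma mp_alg (r : R) : mp φ (algebraMap R _ r) = algebraMap S _ (φ r) := by
  let _ : Algebra R (Weyl S) := ((algebraMap S (Weyl S)).comp φ).toAlgebra'
    (fun c x => Algebra.commutes (φ c) x)
  exact (lft (R := R) (Wx S) (Wy S) yx).commutes r

lemma mp_smul (r : R) (w : Weyl R) : mp φ (r • w) = φ r • mp φ w := by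
  rw [Algebra.smul_def, map_mul, mp_alg, ← Algebra.smul_def]

lemma mp_nf (m : M R) : mp φ (nf m) = nf (map φ m) := by
  induction m using MvPolynomial.induction_on' with
  | monomial s r => simp [nf_mon, mp_smul]
  | add p q h1 h2 => rw [map_add, map_add, map_add, map_add, h1, h2]

lemma sym_mp (w : Weyl R) : sym (mp φ w) = map φ (sym w) := by
  rw [← sym_nf (map φ (sym w)), ← mp_nf, nf_sym]

lemma mp_inj (h : Function.Injective φ) : Function.Injective (mp φ) := by
  intro a b hab
  apply sym_inj
  apply map_injective φ h
  rw [← sym_mp, ← sym_mp, hab]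
end

/-- standard involution -/
def sto : Weyl R →ₐ[R] (Weyl R)ᵐᵒᵖ :=
  lft (MulOpposite.op (Wx R)) (MulOpposite.op (-Wy R)) (by
    apply MulOpposite.unop_injective
    simp
    have h : Wy R * Wx R = Wx R * Wy R + 1 := yx
    have h2 : Wx R * -Wy R = -Wy R * Wx R + 1 := by
      rw [mul_neg (Wx R) (Wy R), neg_mul (Wy R) (Wx R), h]; abel
    exact h2)

def st (w : Weyl R) : Weyl R := (sto w).unop

@[simp] lemma st_x : st (Wx R) = Wx R := by simp [st, sto]
@[simp] lemma st_y : st (Wy R) = -Wy R := by simp [st, sto]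
lemma st_mul (a b : Weyl R) : st (a * b) = st b * st a := by simp [st]
lemma st_add (a b : Weyl R) : st (a + b) = st a + st b := by simp [st]
lemma st_neg (a : Weyl R) : st (-a) = -st a := by simp [st]
lemma st_sub (a b : Weyl R) : st (a - b) = st a - st b := by simp [st]
lemma st_pow (a : Weyl R) (n : ℕ) : st (a ^ n) = st a ^ n := by simp [st]
lemma st_smul (r : R) (a : Weyl R) : st (r • a) = r • st a := by simp [st]
lemma st_one : st (1 : Weyl R) = 1 := by simp [st]
lemma st_alg (r : R) : st (algebraMap R (Weyl R) r) = algebraMap R _ r := by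
  rw [Algebra.algebraMap_eq_smul_one, st_smul, st_one]

lemma st_mp {S : Type} [CommRing S] (φ : R →+* S) (w : Weyl R) : st (mp φ w) = mp φ (st w) := by
  induction w using ind with
  | hx => simp
  | hy => simp
  | hc r => simp [st_alg]
  | ha a b h1 h2 => simp [st_add, h1, h2]
  | hm a b h1 h2 => simp [st_mul, h1, h2]

lemma st_st (w : Weyl R) : st (st w) = w := by
  induction w using ind with
  | hx => simp
  | hy => simp [st_neg]
  | hc r => simp [st_alg]
  | ha a b h1 h2 => simp [st_add, h1, h2]
  | hm a b h1 h2 => simp [st_mul, h1, h2]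

/-! degrees -/

lemma pd_deg (i : Fin 2) (m : M R) : (pderiv i m).totalDegree ≤ m.totalDegree - 1 := by
  rw [totalDegree]
  apply Finset.sup_le
  intro s hs
  rw [mem_support_iff, coeff_pderiv] at hs
  have : s + Finsupp.single i 1 ∈ m.support := by
    rw [mem_support_iff]; intro h; simp [h] at hs
  have := le_totalDegree this
  rw [Finsupp.sum_add_index' (by simp) (by simp), Finsupp.sum_single_index (by simp)] at this
  exact Nat.le_sub_of_add_le this

lemma E_deg (m : M R) (n : ℕ) (hm : m.totalDegree ≤ n) (j : ℕ) :
    ((ov ^ (j + 1)) m - X 1 ^ (j + 1) * m).totalDegree ≤ n + j := by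
  rcases subsingleton_or_nontrivial R with hR | hR
  · rw [Subsingleton.elim ((ov ^ (j + 1)) m - X 1 ^ (j + 1) * m) 0]; simp
  induction j with
  | zero =>
    simp
    exact (pd_deg 0 m).trans (by omega)
  | succ j ih =>
    set E := (ov ^ (j + 1)) m - X 1 ^ (j + 1) * m with hE
    have h0 : (ov ^ (j + 1)) m = E + X 1 ^ (j + 1) * m := by rw [hE]; ring
    have : (ov ^ (j + 1 + 1)) m - X 1 ^ (j + 1 + 1) * m
        = pderiv 0 E + X 1 * E + X 1 ^ (j + 1) * pderiv 0 m := by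
      rw [pow_succ', Module.End.mul_apply, h0, ov_apply, map_add, pderiv_mul, pderiv_pow,
        pderiv_X_of_ne (by decide)]
      ring
    rw [this]
    have hx : (X 1 : M R).totalDegree ≤ 1 := by simp
    have hxp : (X 1 ^ (j + 1) : M R).totalDegree ≤ j + 1 := by simp
    refine (totalDegree_add _ _).trans (max_le ((totalDegree_add _ _).trans (max_le ?_ ?_)) ?_)
    · exact (pd_deg 0 E).trans (by omega)
    · exact (totalDegree_mul _ _).trans (by omega)
    · have := pd_deg 0 m
      exact (totalDegree_mul _ _).trans (by omega)

lemma rho_deg (w : Weyl R) (m : M R) (a n : ℕ) (hw : (sym w).totalDegree ≤ a + 1)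
    (hm : m.totalDegree ≤ n) : (rho w m - sym w * m).totalDegree ≤ a + n := by
  rcases subsingleton_or_nontrivial R with hR | hR
  · rw [Subsingleton.elim (rho w m - sym w * m) 0]; simp
  have e : rho w m - sym w * m = ∑ s ∈ (sym w).support, C (coeff s (sym w)) *
      (X 0 ^ s 0 * ((ov ^ (s 1)) m - X 1 ^ (s 1) * m)) := by
    have h1 : sym w = ∑ s ∈ (sym w).support, monomial s (coeff s (sym w)) := (sym w).as_sum
    have h2 : w = ∑ s ∈ (sym w).support, nf (monomial s (coeff s (sym w))) := by
      rw [← map_sum, ← h1, nf_sym]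
    conv_lhs =>
      rw [h1]
      arg 1
      rw [h2]
    rw [map_sum, LinearMap.sum_apply, Finset.sum_mul, ← Finset.sum_sub_distrib]
    refine Finset.sum_congr rfl fun s _ => ?_
    rw [nf_mon, monomial_eq, Finsupp.prod_fintype _ _ (by simp)]
    have : ∀ k (q : M R), (ou ^ k) q = X 0 ^ k * q := by
      intro k q
      induction k with
      | zero => simp
      | succ k ih => rw [pow_succ', Module.End.mul_apply, ih, ou_apply]; ring
    simp [this, smul_eq_C_mul]
    ring
  rw [e]
  refine totalDegree_finsetSum_le fun s hs => ?_
  have hs' := le_totalDegree hs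
  rw [Finsupp.sum_fintype _ _ (by simp)] at hs'
  simp at hs'
  refine (totalDegree_mul _ _).trans ?_
  rw [totalDegree_C, zero_add]
  rcases h : s 1 with _ | j
  · simp
  · have h1 := E_deg m n hm j
    have hxp : (X 0 ^ (s 0) : M R).totalDegree ≤ s 0 := by simp
    exact (totalDegree_mul _ _).trans (by omega)

lemma rho_C (w : Weyl R) (m : M R) (hw : (sym w).totalDegree = 0) : rho w m = sym w * m := by
  rw [totalDegree_eq_zero_iff_eq_C] at hw
  have : w = algebraMap R _ (coeff 0 (sym w)) := by
    conv_lhs => rw [← nf_sym w, hw]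
    rw [← monomial_zero', nf_mon, Algebra.algebraMap_eq_smul_one]; simp
  rw [hw]
  conv_lhs => rw [this]
  simp [Algebra.algebraMap_eq_smul_one, smul_eq_C_mul]

lemma sym_mul_deg_le (a b : Weyl R) :
    (sym (a * b)).totalDegree ≤ (sym a).totalDegree + (sym b).totalDegree := by
  rw [sym_mul]
  rcases h : (sym a).totalDegree with _ | n
  · rw [rho_C _ _ h]
    exact (totalDegree_mul _ _).trans (by omega)
  · have := rho_deg a (sym b) n _ h.le le_rfl
    have e : rho a (sym b) = (rho a (sym b) - sym a * sym b) + sym a * sym b := by ring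
    rw [e]
    have h2 := totalDegree_mul (sym a) (sym b)
    exact (totalDegree_add _ _).trans (max_le (by omega) (by omega))

lemma sym_pow_deg_le (a : Weyl R) (n : ℕ) :
    (sym (a ^ n)).totalDegree ≤ n * (sym a).totalDegree := by
  induction n with
  | zero => simp
  | succ n ih =>
    rw [pow_succ]
    refine (sym_mul_deg_le _ _).trans ?_
    rw [Nat.succ_mul]; omega

lemma sym_ne {a : Weyl R} (h : a ≠ 0) : sym a ≠ 0 := fun h' => h (sym_inj (by rw [h', map_zero]))

lemma sym_mul_deg [IsDomain R] {a b : Weyl R} (ha : a ≠ 0) (hb : b ≠ 0) :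
    a * b ≠ 0 ∧ (sym (a * b)).totalDegree = (sym a).totalDegree + (sym b).totalDegree := by
  have ha' := sym_ne ha
  have hb' := sym_ne hb
  have key : sym (a * b) ≠ 0 ∧
      (sym (a * b)).totalDegree = (sym a).totalDegree + (sym b).totalDegree := by
    rw [sym_mul]
    rcases h : (sym a).totalDegree with _ | n
    · rw [rho_C _ _ h, totalDegree_mul_of_isDomain ha' hb', h]
      exact ⟨mul_ne_zero ha' hb', rfl⟩
    · have h1 := rho_deg a (sym b) n _ h.le le_rfl
      have e : rho a (sym b) = (rho a (sym b) - sym a * sym b) + sym a * sym b := by ring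
      have h2 := totalDegree_mul_of_isDomain ha' hb'
      have h3 : (rho a (sym b)).totalDegree = (sym a * sym b).totalDegree := by
        rw [e]
        exact totalDegree_add_eq_right_of_totalDegree_lt (by omega)
      refine ⟨?_, by omega⟩
      intro h4
      rw [h4, totalDegree_zero] at h3
      omega
  exact ⟨fun h => key.1 (by rw [h, map_zero]), key.2⟩

instance [Nontrivial R] : Nontrivial (Weyl R) :=
  ⟨0, 1, fun h => by
    have := congrArg sym h
    simp at this⟩

instance [IsDomain R] : NoZeroDivisors (Weyl R) where
  eq_zero_or_eq_zero_of_mul_eq_zero := by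
    intro a b hab
    by_contra! h
    exact (sym_mul_deg h.1 h.2).1 hab

lemma sym_pow_deg [IsDomain R] (a : Weyl R) (n : ℕ) :
    (sym (a ^ n)).totalDegree = n * (sym a).totalDegree := by
  by_cases ha : a = 0
  · subst ha
    rcases n with _ | n
    · simp
    · simp
  induction n with
  | zero => simp
  | succ n ih =>
    rw [pow_succ, (sym_mul_deg (pow_ne_zero n ha) ha).2, ih, Nat.succ_mul]

lemma inj_aux [IsDomain R] {A : Type*} [Ring A] [Algebra R A]
    (hA : Function.Injective (algebraMap R A)) (F : Weyl R →ₐ[R] A) (n : ℕ)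
    (hn : ∀ m : ℕ, 0 < m → m < n → (m : R) ≠ 0) (d : ℕ) : ∀ w : Weyl R,
    (sym w).totalDegree ≤ d → (∀ s, coeff s (sym w) ≠ 0 → s 0 < n ∧ s 1 < n) → F w = 0 → w = 0 := by
  have base : ∀ w : Weyl R, sym w = C (coeff 0 (sym w)) → F w = 0 → w = 0 := by
    intro w hw h0
    have : w = algebraMap R _ (coeff 0 (sym w)) := by
      conv_lhs => rw [← nf_sym w, hw]
      rw [← monomial_zero', nf_mon, Algebra.algebraMap_eq_smul_one]; simp
    rw [this, AlgHom.commutes] at h0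
    rw [this, (map_eq_zero_iff _ hA).1 h0, map_zero]
  induction d with
  | zero =>
    intro w hw _ h0
    exact base w (totalDegree_eq_zero_iff_eq_C.1 (by omega)) h0
  | succ d ih =>
    intro w hw hs h0
    have hx := ih (Wy R * w - w * Wy R) (by
        rw [sym_ady]; exact (pd_deg 0 _).trans (by omega)) (by
        intro s h
        rw [sym_ady, coeff_pderiv] at h
        have := hs _ (left_ne_zero_of_mul h)
        simp at this
        omega) (by simp [h0])
    have hy := ih (w * Wx R - Wx R * w) (by
        rw [sym_adx]; exact (pd_deg 1 _).trans (by omega)) (by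
        intro s h
        rw [sym_adx, coeff_pderiv] at h
        have := hs _ (left_ne_zero_of_mul h)
        simp at this
        omega) (by simp [h0])
    have hd : ∀ i : Fin 2, pderiv i (sym w) = 0 := by
      intro i
      fin_cases i
      · simp only [Fin.zero_eta]; rw [← sym_ady, hx, map_zero]
      · simp only [Fin.mk_one]; rw [← sym_adx, hy, map_zero]
    refine base w ?_ h0
    ext s
    rw [coeff_C]
    split_ifs with h
    · rw [h]
    · by_contra hc
      obtain ⟨i, hi⟩ : ∃ i, s i ≠ 0 := by
        by_contra! h'
        exact h (by ext i; simp [h'])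
      have hle : Finsupp.single i 1 ≤ s := by
        rw [Finsupp.single_le_iff]; omega
      have := congrArg (coeff (s - Finsupp.single i 1)) (hd i)
      rw [coeff_pderiv, tsub_add_cancel_of_le hle, coeff_zero] at this
      have h2 : (((s - Finsupp.single i 1 : Fin 2 →₀ ℕ) i : R) + 1) = (s i : R) := by
        simp only [Finsupp.tsub_apply, Finsupp.single_eq_same]
        rw [Nat.cast_sub (by omega)]; simp
      rw [h2] at this
      rcases mul_eq_zero.1 this with h3 | h3
      · exact hc h3
      · have hb := hs s hc
        refine hn (s i) (by omega) ?_ h3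
        fin_cases i
        exacts [hb.1, hb.2]

end
end WA


namespace WA
section
open MvPolynomial

lemma comm_pows {B : Type} [Ring B] (p : ℕ) (hp : (p : B) = 0) (P Q : B) (h : Q * P = P * Q + 1) :
    Q * P ^ p = P ^ p * Q ∧ Q ^ p * P = P * Q ^ p := by
  let F : Weyl ℤ →ₐ[ℤ] B := lft P Q h
  have h1 := congrArg F (y_mul_xpow (R := ℤ) p)
  have h2 := congrArg F (ypow_mul_x (R := ℤ) p)
  simp only [map_mul, map_pow, map_add, map_natCast, F, lft_x, lft_y, hp, zero_mul, add_zero] at h1 h2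
  exact ⟨h1, h2⟩

lemma cen_aux {B : Type} [Ring B] [IsDomain B] (p : ℕ) [Fact p.Prime] [CharP B p]
    (e : Fin p × Fin p → B) (he : Submodule.span (Subring.center B) (Set.range e) = ⊤)
    (P Q : B) (h : Q * P = P * Q + 1) (T : B) (hP : T * P = P * T) (hQ : T * Q = Q * T) :
    ∀ w, T * w = w * T := by
  classical
  intro w
  set Z := Subring.center B with hZ
  let v : Option (Fin p × Fin p) → B := fun o => o.elim w (fun ij => P ^ (ij.1 : ℕ) * Q ^ (ij.2 : ℕ))
  have hdep : ¬ LinearIndependent Z v := by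
    intro hl
    have : Fintype (Set.range e) := Set.fintypeRange e
    have h1 := linearIndependent_le_span_aux' v hl (Set.range e) (by rw [he]; exact le_top)
    have h2 := Fintype.card_range_le e
    rw [Fintype.card_option] at h1
    omega
  rw [Fintype.not_linearIndependent_iff] at hdep
  obtain ⟨g, hg, i0, hi0⟩ := hdep
  rw [Fintype.sum_option] at hg
  simp only [v, Option.elim] at hg
  have hcom : ∀ x : B, (∃ c : Fin p × Fin p → Z, x = ∑ x, c x • (P ^ (x.1 : ℕ) * Q ^ (x.2 : ℕ))) →
      T * x = x * T := by
    rintro x ⟨c, rfl⟩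
    rw [Finset.mul_sum, Finset.sum_mul]
    refine Finset.sum_congr rfl fun s _ => ?_
    have c1 : Commute T P := hP
    have c2 : Commute T Q := hQ
    rw [Algebra.mul_smul_comm, Algebra.smul_mul_assoc,
      ((c1.pow_right (s.1 : ℕ)).mul_right (c2.pow_right (s.2 : ℕ))).eq]
  have hn : g none ≠ 0 := by
    intro h0
    rw [h0, zero_smul, zero_add] at hg
    let F : Weyl Z →ₐ[Z] B := lft P Q h
    let m : M Z := ∑ ij : Fin p × Fin p,
      monomial (Finsupp.single 0 (ij.1 : ℕ) + Finsupp.single 1 (ij.2 : ℕ)) (g (some ij))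
    have hF : F (nf m) = 0 := by
      rw [← hg]
      simp [m, nf_mon, F, map_sum]
    have hco : ∀ s, coeff s m = ∑ ij : Fin p × Fin p,
      if Finsupp.single 0 (ij.1 : ℕ) + Finsupp.single 1 (ij.2 : ℕ) = s then g (some ij) else 0 := by
      intro s
      simp [m, coeff_sum, coeff_monomial]
    have hw := inj_aux (R := Z) Subtype.val_injective F p (by
      intro k hk hkp hk0
      have hk1 := congrArg (algebraMap Z B) hk0
      rw [map_natCast, map_zero, CharP.cast_eq_zero_iff B p] at hk1
      exact absurd (Nat.le_of_dvd hk hk1) (by omega)) _ (nf m) le_rfl (by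
      intro s hs
      rw [sym_nf, hco] at hs
      obtain ⟨ij, -, hij⟩ := Finset.exists_ne_zero_of_sum_ne_zero hs
      split_ifs at hij with hij2
      · rw [← hij2]
        simp
      · simp at hij) hF
    have hm : m = 0 := by rw [← sym_nf m, hw, map_zero]
    rcases i0 with _ | ij0
    · exact hi0 h0
    · apply hi0
      have := hco (Finsupp.single 0 (ij0.1 : ℕ) + Finsupp.single 1 (ij0.2 : ℕ))
      rw [hm, coeff_zero, Finset.sum_eq_single ij0] at this
      · simpa using this.symm
      · intro b _ hb
        rw [if_neg]
        intro hbe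
        apply hb
        have a0 := DFunLike.congr_fun hbe 0
        have a1 := DFunLike.congr_fun hbe 1
        simp at a0 a1
        ext
        · exact a0
        · exact a1
      · simp
  have h3 := hcom (g none • w) ⟨fun x => - g (some x), by
    rw [eq_neg_of_add_eq_zero_left hg]; simp⟩
  rw [Algebra.mul_smul_comm, Algebra.smul_mul_assoc] at h3
  have h4 : (g none : B) * (T * w) = (g none : B) * (w * T) := h3
  refine mul_left_cancel₀ ?_ h4
  intro h5
  exact hn (Subtype.ext h5)

instance {k : Type} [Field k] : IsDomain (Weyl k) := NoZeroDivisors.to_isDomain _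

lemma charP_weyl {k : Type} [Field k] (p : ℕ) [CharP k p] : CharP (Weyl k) p :=
  charP_of_injective_algebraMap (algebraMap k (Weyl k)).injective p

variable {k : Type} [Field k] (p : ℕ) [Fact p.Prime] [CharP k p]

lemma cast_weyl : (p : Weyl k) = 0 := by
  have := charP_weyl (k := k) p
  exact CharP.cast_eq_zero _ p

lemma cen_of {T : Weyl k} (hx : T * Wx k = Wx k * T) (hy : T * Wy k = Wy k * T) :
    ∀ w, T * w = w * T := by
  intro w
  induction w using ind with
  | hx => exact hx
  | hy => exact hy
  | hc r => exact (Algebra.commutes r T).symm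
  | ha a b h1 h2 => rw [mul_add, add_mul, h1, h2]
  | hm a b h1 h2 => rw [← mul_assoc, h1, mul_assoc, h2, mul_assoc]

lemma xp_cen : ∀ w : Weyl k, Wx k ^ p * w = w * Wx k ^ p := by
  have := comm_pows p (cast_weyl (k := k) p) (Wx k) (Wy k) yx
  exact cen_of (by rw [← pow_succ, pow_succ']) this.1.symm

lemma yp_cen : ∀ w : Weyl k, Wy k ^ p * w = w * Wy k ^ p := by
  have := comm_pows p (cast_weyl (k := k) p) (Wx k) (Wy k) yx
  exact cen_of this.2 (by rw [← pow_succ, pow_succ'])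

lemma span_top : Submodule.span (Subring.center (Weyl k)) (Set.range
    (fun ij : Fin p × Fin p => Wx k ^ (ij.1 : ℕ) * Wy k ^ (ij.2 : ℕ))) = ⊤ := by
  rw [eq_top_iff]
  have hp : 0 < p := (Fact.out : p.Prime).pos
  have key : ∀ m : M k, nf m ∈ Submodule.span (Subring.center (Weyl k)) (Set.range
    (fun ij : Fin p × Fin p => Wx k ^ (ij.1 : ℕ) * Wy k ^ (ij.2 : ℕ))) := by
    intro m
    induction m using MvPolynomial.induction_on' with
    | monomial s r =>
      have hx : Wx k ^ p ∈ Subring.center (Weyl k) :=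
        Subring.mem_center_iff.2 fun g => (xp_cen p g).symm
      have hy : Wy k ^ p ∈ Subring.center (Weyl k) :=
        Subring.mem_center_iff.2 fun g => (yp_cen p g).symm
      have hr : algebraMap k (Weyl k) r ∈ Subring.center (Weyl k) :=
        Subring.mem_center_iff.2 fun g => (Algebra.commutes r g).symm
      let z : Subring.center (Weyl k) := ⟨_, hr⟩ * ⟨_, hx⟩ ^ (s 0 / p) * ⟨_, hy⟩ ^ (s 1 / p)
      have : nf (monomial s r) = z • (Wx k ^ (s 0 % p) * Wy k ^ (s 1 % p)) := by
        have h1 : Wx k ^ s 0 = (Wx k ^ p) ^ (s 0 / p) * Wx k ^ (s 0 % p) := by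
          rw [← pow_mul, ← pow_add, Nat.div_add_mod]
        have h2 : Wy k ^ s 1 = (Wy k ^ p) ^ (s 1 / p) * Wy k ^ (s 1 % p) := by
          rw [← pow_mul, ← pow_add, Nat.div_add_mod]
        have h3 : Commute (Wx k ^ (s 0 % p)) ((Wy k ^ p) ^ (s 1 / p)) :=
          Commute.pow_right (yp_cen p _).symm _
        have h4 : z • (Wx k ^ (s 0 % p) * Wy k ^ (s 1 % p)) =
          (algebraMap k (Weyl k) r * (Wx k ^ p) ^ (s 0 / p) * (Wy k ^ p) ^ (s 1 / p)) *
            (Wx k ^ (s 0 % p) * Wy k ^ (s 1 % p)) := rfl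
        rw [nf_mon, Algebra.smul_def, h4, h1, h2]
        simp only [mul_assoc]
        congr 2
        rw [← mul_assoc, h3.eq, mul_assoc]
      rw [this]
      exact Submodule.smul_mem _ _ (Submodule.subset_span
        ⟨(⟨s 0 % p, Nat.mod_lt _ hp⟩, ⟨s 1 % p, Nat.mod_lt _ hp⟩), rfl⟩)
    | add a b h1 h2 => rw [map_add]; exact add_mem h1 h2
  intro w _
  rw [← nf_sym w]
  exact key _

lemma pow_cen {P Q : Weyl k} (h : Q * P = P * Q + 1) :
    (∀ w, P ^ p * w = w * P ^ p) ∧ ∀ w, Q ^ p * w = w * Q ^ p := by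
  have := charP_weyl (k := k) p
  have hc := comm_pows p (cast_weyl (k := k) p) P Q h
  exact ⟨cen_aux p _ (span_top p) P Q h _ (by rw [← pow_succ, pow_succ']) hc.1.symm,
    cen_aux p _ (span_top p) P Q h _ hc.2 (by rw [← pow_succ, pow_succ'])⟩

lemma dvd_of_pd {m : M k} {i : Fin 2} (h : pderiv i m = 0) (s : Fin 2 →₀ ℕ) (hs : coeff s m ≠ 0) :
    p ∣ s i := by
  by_cases hi : s i = 0
  · simp [hi]
  have hle : Finsupp.single i 1 ≤ s := by
    rw [Finsupp.single_le_iff]; omega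
  have := congrArg (coeff (s - Finsupp.single i 1)) h
  rw [coeff_pderiv, tsub_add_cancel_of_le hle, coeff_zero] at this
  have h2 : (((s - Finsupp.single i 1 : Fin 2 →₀ ℕ) i : k) + 1) = (s i : k) := by
    simp only [Finsupp.tsub_apply, Finsupp.single_eq_same]
    rw [Nat.cast_sub (by omega)]; simp
  rw [h2] at this
  rcases mul_eq_zero.1 this with h3 | h3
  · exact absurd h3 hs
  · exact (CharP.cast_eq_zero_iff k p _).1 h3

lemma ex_expand {T : Weyl k} (h : ∀ w, T * w = w * T) : ∃ Φ : M k, T = nf (expand p Φ) := by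
  have h0 : pderiv 0 (sym T) = 0 := by rw [← sym_ady, h, sub_self, map_zero]
  have h1 : pderiv 1 (sym T) = 0 := by rw [← sym_adx, h, sub_self, map_zero]
  refine ⟨∑ s ∈ (sym T).support,
    monomial (Finsupp.mapRange (fun n => n / p) (Nat.zero_div p) s) (coeff s (sym T)), ?_⟩
  have : expand p (∑ s ∈ (sym T).support,
    monomial (Finsupp.mapRange (fun n => n / p) (Nat.zero_div p) s) (coeff s (sym T))) = sym T := by
    conv_rhs => rw [(sym T).as_sum]
    rw [map_sum]
    refine Finset.sum_congr rfl fun s hs => ?_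
    rw [expand_monomial]
    rw [mem_support_iff] at hs
    have e : p • Finsupp.mapRange (fun n => n / p) (Nat.zero_div p) s = s := by
      ext i
      simp only [Finsupp.smul_apply, Finsupp.mapRange_apply, smul_eq_mul]
      apply Nat.mul_div_cancel'
      fin_cases i
      · exact dvd_of_pd p h0 s hs
      · exact dvd_of_pd p h1 s hs
    rw [e]
  rw [this, nf_sym]

lemma deg_expand (P : Weyl k) (Φ : M k) (h : P ^ p = nf (expand p Φ)) :
    Φ.totalDegree = (sym P).totalDegree := by
  have h1 := sym_pow_deg P p
  rw [h, sym_nf, totalDegree_expand, mul_comm] at h1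
  exact Nat.eq_of_mul_eq_mul_left (Fact.out : p.Prime).pos h1

def sg : M k →ₗ[k] M k :=
  (basisMonomials (Fin 2) k).constr k (fun s => monomial s ((-1) ^ s 1))

lemma sg_mon (s : Fin 2 →₀ ℕ) (r : k) : sg (monomial s r) = monomial s ((-1) ^ s 1 * r) := by
  have : monomial s r = r • basisMonomials (Fin 2) k s := by simp [smul_monomial]
  rw [this, map_smul, sg, Module.Basis.constr_basis, smul_monomial, smul_eq_mul, mul_comm]

lemma coeff_sg (s : Fin 2 →₀ ℕ) (m : M k) : coeff s (sg m) = (-1) ^ s 1 * coeff s m := by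
  classical
  induction m using MvPolynomial.induction_on' with
  | monomial t r =>
    rw [sg_mon, coeff_monomial, coeff_monomial]
    split_ifs with h
    · rw [h]
    · simp
  | add a b h1 h2 => rw [map_add, coeff_add, coeff_add, h1, h2, mul_add]

lemma st_expand (hp : Odd p) (m : M k) : st (nf (expand p m)) = nf (expand p (sg m)) := by
  induction m using MvPolynomial.induction_on' with
  | monomial s r =>
    rw [expand_monomial, sg_mon, expand_monomial, nf_mon, nf_mon, st_smul, st_mul, st_pow, st_pow,
      st_x, st_y]
    simp only [Finsupp.smul_apply, smul_eq_mul]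
    have e1 : (-Wy k) ^ (p * s 1) = ((-1 : k) ^ (s 1)) • Wy k ^ (p * s 1) := by
      rw [show -Wy k = (-1 : k) • Wy k from (neg_one_smul k (Wy k)).symm, smul_pow, pow_mul, hp.neg_one_pow]
    have h3 : Commute (Wx k ^ (p * s 0)) (Wy k ^ (p * s 1)) := by
      rw [pow_mul]
      exact Commute.pow_left (xp_cen p _) _
    rw [e1, smul_mul_assoc, ← h3.eq, smul_smul, mul_comm]
  | add a b h1 h2 => simp only [map_add, st_add, h1, h2]

lemma parity_even (hp : Odd p) {m : M k} (h : st (nf (expand p m)) = nf (expand p m)) :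
    ∀ s, coeff s m ≠ 0 → Even (s 1) := by
  have hp2 : (2 : k) ≠ 0 := by
    intro h2
    have : ((2 : ℕ) : k) = 0 := by exact_mod_cast h2
    rw [CharP.cast_eq_zero_iff k p, Nat.prime_dvd_prime_iff_eq Fact.out Nat.prime_two] at this
    rw [this] at hp
    exact absurd hp (by decide)
  rw [st_expand p hp] at h
  have h1 := congrArg sym h
  rw [sym_nf, sym_nf, expand_inj (Fact.out : p.Prime).pos] at h1
  intro s hs
  by_contra ho
  rw [Nat.not_even_iff_odd] at ho
  have h2 := congrArg (coeff s) h1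
  rw [coeff_sg, ho.neg_one_pow] at h2
  apply hs
  have : 2 * coeff s m = 0 := by linear_combination -h2
  exact (mul_eq_zero.1 this).resolve_left hp2

lemma parity_odd (hp : Odd p) {m : M k} (h : st (nf (expand p m)) = - nf (expand p m)) :
    ∀ s, coeff s m ≠ 0 → Odd (s 1) := by
  have hp2 : (2 : k) ≠ 0 := by
    intro h2
    have : ((2 : ℕ) : k) = 0 := by exact_mod_cast h2
    rw [CharP.cast_eq_zero_iff k p, Nat.prime_dvd_prime_iff_eq Fact.out Nat.prime_two] at this
    rw [this] at hp
    exact absurd hp (by decide)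
  rw [st_expand p hp, ← map_neg, ← map_neg] at h
  have h1 := congrArg sym h
  rw [sym_nf, sym_nf, expand_inj (Fact.out : p.Prime).pos] at h1
  intro s hs
  by_contra ho
  rw [Nat.not_odd_iff_even] at ho
  have h2 := congrArg (coeff s) h1
  rw [coeff_sg, ho.neg_one_pow, coeff_neg] at h2
  apply hs
  have : 2 * coeff s m = 0 := by linear_combination h2
  exact (mul_eq_zero.1 this).resolve_left hp2

end
end WA


namespace WA
section
open MvPolynomial

section abs
variable {A : Type} [Ring A] {U V e : A}

lemma vu1 (h : V * U = U * V + e) (he : ∀ a, e * a = a * e) (a : ℕ) :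
    V * U ^ a = U ^ a * V + e * (a * U ^ (a - 1)) := by
  induction a with
  | zero => simp
  | succ a ih =>
    rw [pow_succ, ← mul_assoc, ih, add_mul, mul_assoc, h, Nat.add_sub_cancel, mul_add, ← he]
    rcases a with _ | a
    · simp
    · simp only [Nat.add_sub_cancel]
      rw [mul_assoc e, mul_assoc _ _ U, ← pow_succ, ← mul_assoc, add_assoc, ← mul_add]
      congr 2
      push_cast
      noncomm_ring

lemma vu2 (h : V * U = U * V + e) (he : ∀ a, e * a = a * e) (hee : e * e = 0) (d a : ℕ) :
    V ^ d * U ^ a = U ^ a * V ^ d + e * ((d * a : ℕ) * (U ^ (a - 1) * V ^ (d - 1))) := by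
  induction d with
  | zero => simp
  | succ d ih =>
    have h1 : e * (V * U ^ (a - 1)) = e * (U ^ (a - 1) * V) := by
      rw [vu1 h he, mul_add, ← mul_assoc e e, hee, zero_mul, add_zero]
    have h5 : V * (e * ((d * a : ℕ) * (U ^ (a - 1) * V ^ (d - 1)))) =
        e * ((d * a : ℕ) * (U ^ (a - 1) * (V * V ^ (d - 1)))) := by
      simp only [← nsmul_eq_mul, mul_smul_comm]
      congr 1
      rw [← mul_assoc V, ← he V, mul_assoc e, ← mul_assoc V, ← mul_assoc e, h1, mul_assoc e,
        mul_assoc _ V]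
    rw [pow_succ', mul_assoc, ih, mul_add, ← mul_assoc V, vu1 h he, add_mul, Nat.add_sub_cancel, h5,
      mul_assoc (U ^ a), add_assoc]
    congr 1
    rcases d with _ | d
    · simp [mul_assoc]
    · rw [Nat.add_sub_cancel, ← pow_succ', mul_assoc e, ← mul_add, mul_assoc, ← add_mul]
      push_cast
      congr 2
      noncomm_ring

lemma vu3 (h : V * U = U * V + e) (he : ∀ a, e * a = a * e) (hee : e * e = 0) (a b c d : ℕ) :
    (U ^ c * V ^ d) * (U ^ a * V ^ b) =
      U ^ (c + a) * V ^ (d + b) + e * ((d * a : ℕ) * (U ^ (c + (a - 1)) * V ^ (d - 1 + b))) := by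
  rw [mul_assoc, ← mul_assoc (V ^ d), vu2 h he hee, add_mul, mul_add, pow_add, pow_add, pow_add,
    pow_add]
  congr 1
  · simp only [mul_assoc]
  · rw [mul_assoc e, ← mul_assoc _ e, ← he, mul_assoc e]
    congr 1
    rw [mul_assoc, ← mul_assoc (U ^ c), ← Nat.cast_comm]
    simp only [mul_assoc]
end abs

lemma pd_iter (k n : ℕ) {R : Type} [CommRing R] :
    ((pderiv (R := R) (0 : Fin 2)).toLinearMap ^ k) ((X 0 : M R) ^ n)
      = (n.descFactorial k : M R) * X 0 ^ (n - k) := by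
  induction k with
  | zero => simp
  | succ k ih =>
    rw [pow_succ', Module.End.mul_apply, ih]
    simp only [Derivation.coeFn_coe, pderiv_mul, pderiv_pow, pderiv_X_self, mul_one]
    rw [Derivation.map_natCast, zero_mul, zero_add, Nat.descFactorial_succ, Nat.sub_sub]
    push_cast
    ring

lemma VU {R : Type} [CommRing R] (p : ℕ) (hp : p.Prime) (h2 : ((p ^ 2 : ℕ) : R) = 0) :
    Wy R ^ p * Wx R ^ p = Wx R ^ p * Wy R ^ p + algebraMap R _ (p.factorial : R) := by
  apply sym_inj
  have h2' : ((p ^ 2 : ℕ) : M R) = 0 := by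
    rw [← map_natCast (C : R →+* M R), h2, map_zero]
  have hx : sym (Wx R ^ p) = X 0 ^ p := by simpa using sym_mon (R := R) p 0
  rw [map_add, sym_mon, sym_mul, hx, map_pow rho, rho_y, ov]
  have hc : Commute ((pderiv (R := R) (0 : Fin 2)).toLinearMap)
    (LinearMap.mulLeft R (X 1) : Module.End R (M R)) := by
    ext1 m
    ext1
    simp [pderiv_mul, pderiv_X_of_ne]
  have hl : ∀ k (m : M R), ((LinearMap.mulLeft R (X 1) : Module.End R (M R)) ^ k) m = X 1 ^ k * m := by
    intro k m
    induction k with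
    | zero => simp
    | succ k ih => rw [pow_succ', Module.End.mul_apply, ih, LinearMap.mulLeft_apply, pow_succ']; ring
  rw [hc.add_pow', LinearMap.sum_apply, Finset.Nat.sum_antidiagonal_eq_sum_range_succ_mk]
  have hterm : ∀ k ∈ Finset.range p, k ≠ 0 → ((p.choose k •
      ((pderiv (R := R) (0 : Fin 2)).toLinearMap ^ k *
        (LinearMap.mulLeft R (X 1) : Module.End R (M R)) ^ (p - k))) (X 0 ^ p) : M R) = 0 := by
    intro k hk hk0
    rw [Finset.mem_range] at hk
    rw [(hc.pow_pow k (p - k)).eq, LinearMap.smul_apply, Module.End.mul_apply, pd_iter, hl]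
    obtain ⟨a, ha⟩ := hp.dvd_choose_self hk0 hk
    obtain ⟨b, hb⟩ : p ∣ p.descFactorial k := by
      obtain ⟨j, rfl⟩ := Nat.exists_eq_succ_of_ne_zero hk0
      obtain ⟨q, rfl⟩ := Nat.exists_eq_succ_of_ne_zero hp.ne_zero
      rw [Nat.succ_eq_add_one, Nat.succ_descFactorial_succ]
      exact Nat.dvd_mul_right _ _
    rw [ha, hb, nsmul_eq_mul]
    push_cast at h2' ⊢
    linear_combination (a * b * X 0 ^ (p - k) * X 1 ^ (p - k)) * h2'
  rw [Finset.sum_range_succ, Finset.sum_eq_single_of_mem 0 (by simp [hp.pos])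
    (fun b hb h => hterm b hb h)]
  congr 1
  · simp [hl]; ring
  · simp only [Nat.choose_self, one_smul, Nat.sub_self, pow_zero, mul_one]
    rw [pd_iter]
    rw [Algebra.algebraMap_eq_smul_one, map_smul, sym_one, smul_eq_C_mul, mul_one, map_natCast]
    simp [Nat.descFactorial_self]

def jac {R : Type} [CommRing R] (Ψ Φ : M R) : M R :=
  pderiv 1 Ψ * pderiv 0 Φ - pderiv 0 Ψ * pderiv 1 Φ

section
variable {R : Type} [CommRing R] (p : ℕ) (hp : p.Prime) (h2 : ((p ^ 2 : ℕ) : R) = 0)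

include hp h2 in
lemma fac_sq : (p.factorial : R) * p = 0 ∧ (p.factorial : R) * p.factorial = 0 := by
  obtain ⟨q, hq⟩ := Nat.dvd_factorial hp.pos le_rfl
  rw [hq]
  push_cast at h2 ⊢
  constructor
  · linear_combination (q : R) * h2
  · linear_combination (q : R) ^ 2 * h2

lemma nf_exp_mon (s : Fin 2 →₀ ℕ) (r : R) :
    nf (expand p (monomial s r)) = r • ((Wx R ^ p) ^ s 0 * (Wy R ^ p) ^ s 1) := by
  rw [expand_monomial, nf_mon]
  simp [pow_mul]

include hp h2 in
lemma comm_C (Ψ Φ : M R) : nf (expand p Ψ) * nf (expand p Φ) - nf (expand p Φ) * nf (expand p Ψ)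
    = (p.factorial : R) • nf (expand p (jac Ψ Φ)) := by
  induction Ψ using MvPolynomial.induction_on' with
  | monomial t ψ =>
    induction Φ using MvPolynomial.induction_on' with
    | monomial s φ =>
      have hee : algebraMap R (Weyl R) (p.factorial : R) * algebraMap R (Weyl R) (p.factorial : R) = 0 := by
        rw [← map_mul, (fac_sq p hp h2).2, map_zero]
      have he : ∀ a, algebraMap R (Weyl R) (p.factorial : R) * a = a * algebraMap R (Weyl R) (p.factorial : R) :=
        fun a => Algebra.commutes _ a
      have e1 := vu3 (VU p hp h2) he hee (s 0) (s 1) (t 0) (t 1)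
      have e2 := vu3 (VU p hp h2) he hee (t 0) (t 1) (s 0) (s 1)
      rw [jac, pderiv_monomial, pderiv_monomial, pderiv_monomial, pderiv_monomial, monomial_mul,
        monomial_mul, map_sub, map_sub, nf_exp_mon, nf_exp_mon, nf_exp_mon, nf_exp_mon,
        smul_mul_smul_comm, smul_mul_smul_comm, e1, e2]
      simp only [← nsmul_eq_mul, ← Algebra.smul_def, ← Nat.cast_smul_eq_nsmul R]
      simp only [Finsupp.add_apply, Finsupp.tsub_apply, Finsupp.single_eq_same, ne_eq,
        Finsupp.single_apply, one_ne_zero, zero_ne_one, if_true, if_false, Nat.sub_zero]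
      rw [add_comm (s 0) (t 0), add_comm (s 1) (t 1), add_comm (s 0) (t 0 - 1),
        add_comm (s 1 - 1) (t 1)]
      module
    | add a b h1 h2 =>
      rw [map_add, map_add, mul_add, add_mul, add_sub_add_comm, h1, h2, ← smul_add, ← map_add,
        ← map_add]
      congr 3
      simp only [jac, map_add]; ring
  | add a b h1 h2 =>
    rw [map_add, map_add, mul_add, add_mul, add_sub_add_comm, h1, h2, ← smul_add, ← map_add,
      ← map_add]
    congr 3
    simp only [jac, map_add]; ring

include hp h2 in
lemma comm_PQ {P Q : Weyl R} (h : Q * P = P * Q + 1) :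
    Q ^ p * P ^ p - P ^ p * Q ^ p = (p.factorial : R) • (1 : Weyl R) := by
  have := congrArg (lft (R := R) P Q h) (VU p hp h2)
  simp only [map_mul, map_pow, map_add, lft_x, lft_y, AlgHom.commutes] at this
  rw [this, Algebra.algebraMap_eq_smul_one]
  exact add_sub_cancel_left _ _

lemma pc_mul {r : R} {a b : Weyl R} (ha : ∀ w, r • (a * w) = r • (w * a))
    (hb : ∀ w, r • (b * w) = r • (w * b)) (w : Weyl R) : r • ((a * b) * w) = r • (w * (a * b)) := by
  rw [mul_assoc a b w, ha, mul_assoc b w a, hb, mul_assoc]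

lemma pc_pow {r : R} {a : Weyl R} (ha : ∀ w, r • (a * w) = r • (w * a)) (n : ℕ) :
    ∀ w, r • (a ^ n * w) = r • (w * a ^ n) := by
  induction n with
  | zero => simp
  | succ n ih => rw [pow_succ]; exact pc_mul ih ha

lemma pc_of {r : R} {a : Weyl R} (hx : r • (a * Wx R) = r • (Wx R * a))
    (hy : r • (a * Wy R) = r • (Wy R * a)) (w : Weyl R) : r • (a * w) = r • (w * a) := by
  induction w using ind with
  | hx => exact hx
  | hy => exact hy
  | hc c => rw [Algebra.commutes]
  | ha b c h1 h2 => rw [mul_add, add_mul, smul_add, smul_add, h1, h2]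
  | hm b c h1 h2 =>
    rw [← mul_assoc, ← smul_mul_assoc, h1, smul_mul_assoc, mul_assoc, ← mul_smul_comm, h2,
      mul_smul_comm, mul_assoc]

include h2 in
lemma pC_cen (Φ : M R) (w : Weyl R) :
    (p : R) • (nf (expand p Φ) * w) = (p : R) • (w * nf (expand p Φ)) := by
  induction Φ using MvPolynomial.induction_on' with
  | monomial s r =>
    rw [nf_exp_mon, smul_mul_assoc, mul_smul_comm, smul_comm (p : R) r, smul_comm (p : R) r]
    congr 1
    have hpp : ∀ w : Weyl R, (p : R) • ((p : Weyl R) * w) = 0 := by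
      intro w
      rw [← nsmul_eq_mul, ← Nat.cast_smul_eq_nsmul R, smul_smul, ← pow_two]
      push_cast at h2
      rw [h2, zero_smul]
    refine pc_mul (pc_pow (pc_of ?_ ?_) _) (pc_pow (pc_of ?_ ?_) _) w
    · rw [← pow_succ, pow_succ']
    · rw [y_mul_xpow, smul_add, hpp, add_zero]
    · rw [ypow_mul_x, smul_add, hpp, add_zero]
    · rw [← pow_succ, pow_succ']
  | add a b h1 h2 => simp only [map_add, mul_add, add_mul, smul_add, h1, h2]
end

lemma zk (p : ℕ) [Fact p.Prime] (r : ZMod (p ^ 2))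
    (hr : ZMod.castHom (dvd_pow_self p two_ne_zero) (ZMod p) r = 0) :
    ∃ r', r = (p : ZMod (p ^ 2)) * r' := by
  have : NeZero (p ^ 2) := ⟨pow_ne_zero 2 (Fact.out : p.Prime).ne_zero⟩
  rw [← ZMod.natCast_zmod_val r, map_natCast, ZMod.natCast_eq_zero_iff] at hr
  obtain ⟨c, hc⟩ := hr
  refine ⟨c, ?_⟩
  rw [← ZMod.natCast_zmod_val r, hc]
  push_cast
  rfl

lemma zf (p : ℕ) [Fact p.Prime] (r : ZMod (p ^ 2)) (hr : (p.factorial : ZMod (p ^ 2)) * r = 0) :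
    ZMod.castHom (dvd_pow_self p two_ne_zero) (ZMod p) r = 0 := by
  have hp : p.Prime := Fact.out
  have : NeZero (p ^ 2) := ⟨pow_ne_zero 2 hp.ne_zero⟩
  rw [← ZMod.natCast_zmod_val r, map_natCast, ZMod.natCast_eq_zero_iff]
  rw [← ZMod.natCast_zmod_val r, ← Nat.cast_mul, ZMod.natCast_eq_zero_iff] at hr
  generalize r.val = n at hr ⊢
  rw [← Nat.mul_factorial_pred hp.ne_zero, pow_two, mul_assoc] at hr
  have h1 := Nat.dvd_of_mul_dvd_mul_left hp.pos hr
  rcases hp.dvd_mul.1 h1 with h | h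
  · rw [hp.dvd_factorial] at h
    have := hp.pos
    omega
  · exact h

lemma lift_w (p : ℕ) [Fact p.Prime] (w : Weyl (ZMod (p ^ 2)))
    (hw : mp (ZMod.castHom (dvd_pow_self p two_ne_zero) (ZMod p)) w = 0) :
    ∃ w', w = (p : ZMod (p ^ 2)) • w' := by
  have h1 := congrArg sym hw
  rw [sym_mp, map_zero] at h1
  have h2 : ∀ s, ∃ r', coeff s (sym w) = (p : ZMod (p ^ 2)) * r' := by
    intro s
    apply zk
    have := congrArg (coeff s) h1
    rwa [coeff_map, coeff_zero] at this
  choose r hr using h2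
  refine ⟨nf (∑ s ∈ (sym w).support, monomial s (r s)), ?_⟩
  rw [← map_smul, Finset.smul_sum]
  conv_lhs => rw [← nf_sym w, (sym w).as_sum]
  congr 1
  refine Finset.sum_congr rfl fun s _ => ?_
  rw [smul_monomial, smul_eq_mul, ← hr]

lemma comm_aux {R A : Type} [CommRing R] [Ring A] [Algebra R A] (p : R) (hp : p * p = 0)
    (a b c d : A) (hb : p • (b * c) = p • (c * b)) (hd : p • (d * a) = p • (a * d)) :
    (a + p • c) * (b + p • d) - (b + p • d) * (a + p • c) = a * b - b * a := by
  have h1 : p • p • (c * d) = 0 := by rw [smul_smul, hp, zero_smul]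
  have h2 : p • p • (d * c) = 0 := by rw [smul_smul, hp, zero_smul]
  simp only [mul_add, add_mul, smul_mul_assoc, mul_smul_comm, smul_add, h1, h2, hb, hd]
  abel

lemma jac_map {R S : Type} [CommRing R] [CommRing S] (φ : R →+* S) (Ψ Φ : M R) :
    map φ (jac Ψ Φ) = jac (map φ Ψ) (map φ Φ) := by
  simp [jac, pderiv_map]

lemma jac_one (p : ℕ) [Fact p.Prime] {P Q : Weyl (ZMod (p ^ 2))} (h : Q * P = P * Q + 1)
    {Φ Ψ : M (ZMod p)}
    (hP : mp (ZMod.castHom (dvd_pow_self p two_ne_zero) (ZMod p)) P ^ p = nf (expand p Φ))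
    (hQ : mp (ZMod.castHom (dvd_pow_self p two_ne_zero) (ZMod p)) Q ^ p = nf (expand p Ψ)) :
    jac Ψ Φ = 1 := by
  have hp : p.Prime := Fact.out
  have h2 : ((p ^ 2 : ℕ) : ZMod (p ^ 2)) = 0 := ZMod.natCast_self _
  have hpp : (p : ZMod (p ^ 2)) * p = 0 := by rw [← pow_two]; exact_mod_cast h2
  set π := ZMod.castHom (dvd_pow_self p two_ne_zero) (ZMod p) with hπ
  obtain ⟨Φ', rfl⟩ := map_surjective π (ZMod.castHom_surjective _) Φ
  obtain ⟨Ψ', rfl⟩ := map_surjective π (ZMod.castHom_surjective _) Ψ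
  rw [← map_expand, ← mp_nf, ← map_pow, ← sub_eq_zero, ← map_sub] at hP hQ
  obtain ⟨a, ha⟩ := lift_w p _ hP
  obtain ⟨b, hb⟩ := lift_w p _ hQ
  have h3 := comm_PQ p hp h2 h
  rw [eq_add_of_sub_eq' ha, eq_add_of_sub_eq' hb, comm_aux _ hpp _ _ _ _ (pC_cen p h2 _ _)
    (pC_cen p h2 _ _).symm, comm_C p hp h2] at h3
  have h4 := congrArg sym h3
  rw [map_smul, map_smul, sym_nf, sym_one, ← sub_eq_zero, ← smul_sub] at h4
  have h5 : map π (expand p (jac Ψ' Φ') - 1) = 0 := by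
    ext s
    rw [coeff_map, coeff_zero]
    apply zf
    have := congrArg (coeff s) h4
    rwa [coeff_smul, smul_eq_mul, coeff_zero] at this
  rw [map_sub, map_one, map_expand, jac_map, sub_eq_zero] at h5
  rw [← map_one (expand p)] at h5
  exact expand_injective hp.pos h5

end
end WA


namespace WA
section
open MvPolynomial

lemma coeff_euler {R : Type} [CommRing R] (i : Fin 2) (m : M R) (s : Fin 2 →₀ ℕ) :
    coeff s (X i * pderiv i m) = (s i : R) * coeff s m := by
  classical
  induction m using MvPolynomial.induction_on' with
  | monomial t r =>
    rw [X_mul_pderiv_monomial, coeff_smul, coeff_monomial]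
    split_ifs with h
    · rw [h, nsmul_eq_mul]
    · simp
  | add a b h1 h2 => rw [map_add, mul_add, coeff_add, coeff_add, h1, h2, mul_add]

lemma coeff_jac {R : Type} [CommRing R] (Ψ Φ : M R) (n : Fin 2 →₀ ℕ) :
    coeff n (X 0 * X 1 * jac Ψ Φ) = ∑ x ∈ Finset.HasAntidiagonal.antidiagonal n,
      ((x.1 1 : R) * x.2 0 - x.1 0 * x.2 1) * (coeff x.1 Ψ * coeff x.2 Φ) := by
  classical
  have : X 0 * X 1 * jac Ψ Φ = (X 1 * pderiv 1 Ψ) * (X 0 * pderiv 0 Φ) -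
      (X 0 * pderiv 0 Ψ) * (X 1 * pderiv 1 Φ) := by rw [jac]; ring
  rw [this, coeff_sub, coeff_mul, coeff_mul, ← Finset.sum_sub_distrib]
  refine Finset.sum_congr rfl fun x _ => ?_
  simp only [coeff_euler]
  ring

lemma coeff_jac_one {R : Type} [CommRing R] {Ψ Φ : M R} (h : jac Ψ Φ = 1) (n : Fin 2 →₀ ℕ) 
    (hn : ¬ (n 0 = 1 ∧ n 1 = 1)) : coeff n (X 0 * X 1 * jac Ψ Φ) = 0 := by
  classical
  rw [h, mul_one, show (X 0 * X 1 : M R) = monomial (Finsupp.single 0 1 + Finsupp.single 1 1) 1 by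
    rw [X, X, monomial_mul, mul_one], coeff_monomial, if_neg]
  rintro rfl
  apply hn
  simp

variable {k : Type} [Field k] (p : ℕ) [CharP k p] (N : ℕ) (hpN : 2 * N + 2 < p)
  {Φ Ψ : M k} (hj : jac Ψ Φ = 1)
  (hΦ : ∀ s, coeff s Φ ≠ 0 → s 0 ≤ N ∧ s 1 ≤ N ∧ Even (s 1))
  (hΨ : ∀ s, coeff s Ψ ≠ 0 → s 0 ≤ N ∧ s 1 ≤ N ∧ Odd (s 1))

include hj hΦ hΨ in
lemma exist_lin : (∃ s, coeff s Φ ≠ 0 ∧ s 0 = 1 ∧ s 1 = 0) ∧ ∃ s, coeff s Ψ ≠ 0 ∧ s 0 = 0 ∧ s 1 = 1 := by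
  classical
  have h1 := coeff_jac Ψ Φ (Finsupp.single 0 1 + Finsupp.single 1 1)
  rw [hj, mul_one, show (X 0 * X 1 : M k) = monomial (Finsupp.single 0 1 + Finsupp.single 1 1) 1 by
    rw [X, X, monomial_mul, mul_one], coeff_monomial, if_pos rfl] at h1
  obtain ⟨x, hx, hne⟩ := Finset.exists_ne_zero_of_sum_ne_zero (h1 ▸ one_ne_zero)
  rw [Finset.HasAntidiagonal.mem_antidiagonal] at hx
  have h0 := DFunLike.congr_fun hx 0
  have h1 := DFunLike.congr_fun hx 1
  simp at h0 h1
  have ha := right_ne_zero_of_mul hne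
  have hb := left_ne_zero_of_mul ha
  have hc := right_ne_zero_of_mul ha
  have hd := left_ne_zero_of_mul hne
  have o1 := (hΨ _ hb).2.2.pos
  have e2 : x.1 1 = 1 := by omega
  have e3 : x.2 1 = 0 := by omega
  have e4 : x.2 0 = 1 := by
    rcases Nat.eq_zero_or_pos (x.2 0) with h | h
    · rw [h, e3] at hd; simp at hd
    · omega
  exact ⟨⟨_, hc, e4, e3⟩, ⟨_, hb, by omega, e2⟩⟩

include hpN hj hΦ hΨ in
lemma wlem (A B : ℕ) (hA : 0 < A) (h1 : ∀ s, coeff s Φ ≠ 0 → B * s 0 ≤ B + A * s 1)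
    (h2 : ∀ s, coeff s Ψ ≠ 0 → B * s 0 + A ≤ A * s 1) :
    (∀ s, coeff s Φ ≠ 0 → B * s 0 = B + A * s 1 → s 0 ≤ 1) ∧
    (∀ s, coeff s Ψ ≠ 0 → B * s 0 + A = A * s 1 → s 0 = 0) := by
  classical
  obtain ⟨⟨s1, c1, c2, c3⟩, ⟨t1, d1, d2, d3⟩⟩ := exist_lin N hj hΦ hΨ
  obtain ⟨s, hs, hsm⟩ := Finset.exists_max_image
    (Φ.support.filter (fun s => B * s 0 = B + A * s 1)) (fun s => s 0) ⟨s1, by simp [c1, c2, c3]⟩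
  obtain ⟨t, ht, htm⟩ := Finset.exists_max_image
    (Ψ.support.filter (fun s => B * s 0 + A = A * s 1)) (fun s => s 0) ⟨t1, by simp [d1, d2, d3]⟩
  simp only [Finset.mem_filter, mem_support_iff] at hs ht hsm htm
  have hs0 : 1 ≤ s 0 := by
    have := hsm s1 ⟨c1, by simp [c2, c3]⟩
    omega
  obtain ⟨a, ha⟩ := Nat.exists_eq_add_of_le hs0
  have ht1 : 1 ≤ t 1 := (hΨ _ ht.1).2.2.pos
  obtain ⟨b, hb⟩ := Nat.exists_eq_add_of_le ht1
  have es : B * a = A * s 1 := by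
    have := hs.2; rw [ha] at this; linarith
  have et : B * t 0 = A * b := by
    have := ht.2; rw [hb] at this; linarith
  have ecross : t 0 * s 1 = b * a := by
    apply Nat.eq_of_mul_eq_mul_left hA
    calc A * (t 0 * s 1) = t 0 * (A * s 1) := by ring
      _ = (B * t 0) * a := by rw [← es]; ring
      _ = A * (b * a) := by rw [et]; ring
  have hsum : coeff (t + s) (X 0 * X 1 * jac Ψ Φ) =
      ((t 1 : k) * s 0 - t 0 * s 1) * (coeff t Ψ * coeff s Φ) := by
    rw [coeff_jac, Finset.sum_eq_single (t, s)]
    · intro x hx hne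
      rw [Finset.HasAntidiagonal.mem_antidiagonal] at hx
      by_contra hc
      have hc2 := right_ne_zero_of_mul hc
      have q1 := left_ne_zero_of_mul hc2
      have q2 := right_ne_zero_of_mul hc2
      apply hne
      have e0 := DFunLike.congr_fun hx 0
      have e1 := DFunLike.congr_fun hx 1
      simp at e0 e1
      have i1 := h1 _ q2
      have i2 := h2 _ q1
      have i3 : B * x.1 0 + B * x.2 0 = B * t 0 + B * s 0 := by rw [← mul_add, e0, mul_add]
      have i4 : A * x.1 1 + A * x.2 1 = A * t 1 + A * s 1 := by rw [← mul_add, e1, mul_add]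
      have hs2 := hs.2
      have ht2 := ht.2
      have j1 := hsm x.2 ⟨q2, by omega⟩
      have j2 := htm x.1 ⟨q1, by omega⟩
      have k1 : x.1 0 = t 0 := by omega
      have k2 : x.2 0 = s 0 := by omega
      have k3 : x.1 1 = t 1 := by
        apply Nat.eq_of_mul_eq_mul_left hA
        have k5 : B * x.1 0 = B * t 0 := by rw [k1]
        have k6 : B * x.2 0 = B * s 0 := by rw [k2]
        clear es et ha hb ecross i3
        omega
      have k4 : x.2 1 = s 1 := by omega
      ext i
      · fin_cases i
        exacts [k1, k3]
      · fin_cases i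
        exacts [k2, k4]
    · intro h; simp at h
  have hk : ((t 1 : k) * s 0 - t 0 * s 1) = ((1 + a + b : ℕ) : k) := by
    rw [ha, hb, ← Nat.cast_mul, ← Nat.cast_mul, ecross]
    push_cast
    ring
  have hne : ((1 + a + b : ℕ) : k) ≠ 0 := by
    intro h
    rw [CharP.cast_eq_zero_iff k p] at h
    have := Nat.le_of_dvd (by omega) h
    have := hΦ s hs.1
    have := hΨ t ht.1
    omega
  by_cases hn : (t + s) 0 = 1 ∧ (t + s) 1 = 1
  · simp at hn
    constructor
    · intro s' hs' he
      have := hsm s' ⟨hs', he⟩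
      omega
    · intro s' hs' he
      have := htm s' ⟨hs', he⟩
      omega
  · exfalso
    have := coeff_jac_one hj _ hn
    rw [hsum, hk] at this
    exact mul_ne_zero hne (mul_ne_zero ht.1 hs.1) this

include hpN hj hΦ hΨ in
lemma psi_y : ∀ t, coeff t Ψ ≠ 0 → t 0 = 0 := by
  classical
  obtain ⟨a1, a2⟩ := wlem p N hpN hj hΦ hΨ 1 0 one_pos (by simp) (by
    intro s hs
    have := (hΨ s hs).2.2.pos
    omega)
  have b1 : ∀ s, coeff s Φ ≠ 0 → 2 ≤ s 0 → 0 < s 1 := by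
    intro s hs h
    by_contra h0
    have := a1 s hs (by omega)
    omega
  have b2 : ∀ s, coeff s Ψ ≠ 0 → 1 ≤ s 0 → 1 < s 1 := by
    intro s hs h
    have := (hΨ s hs).2.2.pos
    by_contra h0
    have := a2 s hs (by omega)
    omega
  let T : Finset (ℕ × ℕ) := (Φ.support.filter (fun s => 2 ≤ s 0)).image (fun s => (s 0 - 1, s 1)) ∪
    (Ψ.support.filter (fun s => 1 ≤ s 0)).image (fun s => (s 0, s 1 - 1))
  have hT : ∀ x, x ∈ T ↔ (∃ s, coeff s Φ ≠ 0 ∧ 2 ≤ s 0 ∧ (s 0 - 1, s 1) = x) ∨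
      ∃ s, coeff s Ψ ≠ 0 ∧ 1 ≤ s 0 ∧ (s 0, s 1 - 1) = x := by
    intro x
    simp [T, and_assoc]
  rcases T.eq_empty_or_nonempty with hE | hE
  · intro t ht
    by_contra h0
    have : (t 0, t 1 - 1) ∈ T := (hT _).2 (Or.inr ⟨t, ht, by omega, rfl⟩)
    rw [hE] at this
    simp at this
  · exfalso
    obtain ⟨⟨A, B⟩, hx, hmax⟩ := Finset.exists_max_image T (fun x => (x.1 : ℚ) / x.2) hE
    have hpos : ∀ x ∈ T, 0 < x.1 ∧ 0 < x.2 := by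
      intro x hx
      rcases (hT x).1 hx with ⟨s, hs, h2, rfl⟩ | ⟨s, hs, h2, rfl⟩
      · have := b1 s hs h2
        exact ⟨by simp; omega, this⟩
      · have := b2 s hs h2
        exact ⟨h2, by simp; omega⟩
    have hcmp : ∀ x ∈ T, x.1 * B ≤ A * x.2 := by
      intro x hx'
      have h1 := hmax x hx'
      have p1 := (hpos x hx').2
      have p2 := (hpos _ hx).2
      simp only at h1 p2
      rw [div_le_div_iff₀ (by exact_mod_cast p1) (by exact_mod_cast p2)] at h1
      exact_mod_cast h1
    have hA := (hpos _ hx).1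
    have hB := (hpos _ hx).2
    simp only at hA hB
    obtain ⟨c1, c2⟩ := wlem p N hpN hj hΦ hΨ A B hA (by
      intro s hs
      rcases Nat.lt_or_ge (s 0) 2 with h | h
      · have : B * s 0 ≤ B * 1 := Nat.mul_le_mul_left _ (by omega)
        have := Nat.zero_le (A * s 1)
        omega
      · have := hcmp _ ((hT _).2 (Or.inl ⟨s, hs, h, rfl⟩))
        obtain ⟨a, ha⟩ := Nat.exists_eq_add_of_le h
        simp only at this
        rw [ha, show 2 + a - 1 = 1 + a by omega] at this
        rw [ha]
        nlinarith) (by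
      intro s hs
      have h1 := (hΨ s hs).2.2.pos
      rcases Nat.eq_zero_or_pos (s 0) with h | h
      · rw [h]
        have : A * 1 ≤ A * s 1 := Nat.mul_le_mul_left _ (by omega)
        omega
      · have := hcmp _ ((hT _).2 (Or.inr ⟨s, hs, h, rfl⟩))
        obtain ⟨b, hb⟩ := Nat.exists_eq_add_of_le h1
        simp only at this
        rw [hb] at this ⊢
        simp at this
        nlinarith)
    rcases (hT _).1 hx with ⟨s, hs, h2, he⟩ | ⟨s, hs, h2, he⟩
    · simp at he
      have := c1 s hs (by
        obtain ⟨a, ha⟩ := Nat.exists_eq_add_of_le h2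
        rw [ha] at he ⊢
        rw [← he.1, he.2, show 2 + a - 1 = 1 + a by omega]
        ring)
      omega
    · simp at he
      have := c2 s hs (by
        have h1 := (hΨ s hs).2.2.pos
        obtain ⟨b, hb⟩ := Nat.exists_eq_add_of_le h1
        rw [hb] at he ⊢
        rw [← he.2, he.1]
        simp; ring)
      omega

include hpN hj hΦ hΨ in
lemma comm_lem : Ψ.totalDegree ≤ 1 := by
  have h0 := psi_y p N hpN hj hΦ hΨ
  have hd : pderiv 0 Ψ = 0 := by
    ext s
    rw [coeff_pderiv, coeff_zero]
    by_contra h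
    have := h0 _ (left_ne_zero_of_mul h)
    simp at this
  rw [jac, hd, zero_mul, sub_zero] at hj
  have hu : IsUnit (pderiv 1 Ψ) := IsUnit.of_mul_eq_one _ hj
  obtain ⟨c, hc⟩ := (MvPolynomial.isUnit_iff_eq_C_of_isReduced).1 hu
  rw [totalDegree]
  apply Finset.sup_le
  intro s hs
  rw [mem_support_iff] at hs
  rw [Finsupp.sum_fintype _ _ (by simp)]
  simp only [Fin.sum_univ_two]
  rw [h0 s hs, zero_add]
  by_contra hgt
  have hle : Finsupp.single 1 1 ≤ s := by
    rw [Finsupp.single_le_iff]; omega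
  have h3 := congrArg (coeff (s - Finsupp.single 1 1)) hc.2
  classical
  rw [coeff_pderiv, tsub_add_cancel_of_le hle, coeff_C, if_neg] at h3
  · have h2 : (((s - Finsupp.single 1 1 : Fin 2 →₀ ℕ) 1 : k) + 1) = (s 1 : k) := by
      simp only [Finsupp.tsub_apply, Finsupp.single_eq_same]
      rw [Nat.cast_sub (by omega)]; simp
    rw [h2] at h3
    have h4 := (mul_eq_zero.1 h3).resolve_left hs
    rw [CharP.cast_eq_zero_iff k p] at h4
    have := Nat.le_of_dvd (by omega) h4
    have := hΨ s hs
    omega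
  · intro h
    have := DFunLike.congr_fun h 1
    simp at this
    omega

end
end WA


namespace WA
section

lemma schur (G : Polynomial ℤ) (hG : 0 < G.natDegree) (N : ℕ) :
    ∃ p : ℕ, p.Prime ∧ N < p ∧ ∃ t : ℤ, (p : ℤ) ∣ G.eval t := by
  by_cases hc : G.eval 0 = 0
  · obtain ⟨p, h1, h2⟩ := Nat.exists_infinite_primes (N + 1)
    exact ⟨p, h2, by omega, 0, by simp [hc]⟩
  set c := G.eval 0 with hcd
  have hx : ∃ x : ℤ, G.eval (c * (N.factorial : ℤ) * x) ≠ c ∧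
      G.eval (c * (N.factorial : ℤ) * x) ≠ -c := by
    by_contra hcon
    push Not at hcon
    have hz : G ^ 2 - Polynomial.C (c ^ 2) = 0 := by
      apply Polynomial.eq_zero_of_infinite_isRoot
      have hi : Function.Injective (fun x : ℤ => c * (N.factorial : ℤ) * x) := by
        intro a b h
        have h0 : c * (N.factorial : ℤ) ≠ 0 :=
          mul_ne_zero hc (by exact_mod_cast Nat.factorial_ne_zero N)
        exact mul_left_cancel₀ h0 h
      refine (Set.infinite_range_of_injective hi).mono ?_
      rintro _ ⟨x, rfl⟩
      simp only [Set.mem_ofPred_eq, Polynomial.IsRoot.def, Polynomial.eval_sub,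
        Polynomial.eval_pow, Polynomial.eval_C]
      by_cases h : G.eval (c * (N.factorial : ℤ) * x) = c
      · rw [h]; ring
      · rw [hcon x h]; ring
    have h2 : G ^ 2 = Polynomial.C (c ^ 2) := sub_eq_zero.mp hz
    have h3 := congrArg Polynomial.natDegree h2
    rw [Polynomial.natDegree_pow, Polynomial.natDegree_C] at h3
    omega
  obtain ⟨x, h1, h2⟩ := hx
  have he : G.eval (c * (N.factorial : ℤ) * x) =
      c * (1 + N.factorial * x * G.divX.eval (c * (N.factorial : ℤ) * x)) := by
    conv_lhs => rw [← Polynomial.divX_mul_X_add G]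
    rw [Polynomial.eval_add, Polynomial.eval_mul, Polynomial.eval_X, Polynomial.eval_C,
      Polynomial.coeff_zero_eq_eval_zero, ← hcd]
    ring
  set q := 1 + N.factorial * x * G.divX.eval (c * (N.factorial : ℤ) * x) with hq
  have hq1 : q.natAbs ≠ 1 := by
    intro h
    rcases Int.natAbs_eq q with h' | h' <;> rw [h] at h' <;> rw [h'] at he
    · exact h1 (by rw [he]; simp)
    · exact h2 (by rw [he]; simp)
  obtain ⟨p, hp, hd⟩ := Nat.exists_prime_and_dvd hq1
  have hd' : (p : ℤ) ∣ q := Int.natCast_dvd.mpr hd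
  refine ⟨p, hp, ?_, _, he ▸ dvd_mul_of_dvd_right hd' c⟩
  by_contra hle
  have h3 : (p : ℤ) ∣ N.factorial := by
    exact_mod_cast (hp.dvd_factorial).mpr (not_lt.mp hle)
  have h4 : (p : ℤ) ∣ 1 := by
    have h5 := dvd_sub hd' (dvd_mul_of_dvd_left (dvd_mul_of_dvd_left h3 x)
      (G.divX.eval (c * (N.factorial : ℤ) * x)))
    rwa [hq, add_sub_cancel_right] at h5
  have := Int.eq_one_of_dvd_one (by positivity) h4
  exact hp.one_lt.ne' (by exact_mod_cast this)

lemma clr (f : Polynomial ℚ) : ∃ d : ℤ, d ≠ 0 ∧ ∃ H : Polynomial ℤ,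
    H.map (Int.castRingHom ℚ) = Polynomial.C (d : ℚ) * f := by
  refine ⟨_, nonZeroDivisors.ne_zero (IsLocalization.integerNormalization_map_to_map
    (nonZeroDivisors ℤ) f).choose.2, IsLocalization.integerNormalization (nonZeroDivisors ℤ) f, ?_⟩
  have := (IsLocalization.integerNormalization_map_to_map (nonZeroDivisors ℤ) f).choose_spec
  rw [← Polynomial.smul_eq_C_mul]
  rw [Int.cast_smul_eq_zsmul]
  exact this

lemma norm_one_of {p : ℕ} [Fact p.Prime] (d : ℤ) (h0 : d ≠ 0) (h : d.natAbs < p) :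
    ‖(d : ℤ_[p])‖ = 1 := by
  by_contra hn
  have h1 : ‖(d : ℤ_[p])‖ < 1 := lt_of_le_of_ne (PadicInt.norm_le_one _) hn
  rw [PadicInt.norm_int_lt_one_iff_dvd] at h1
  have := Nat.le_of_dvd (Int.natAbs_pos.mpr h0) (Int.natCast_dvd.mp h1)
  omega

lemma lemB (L : Type) [Field L] [Algebra ℚ L] [FiniteDimensional ℚ L] (s : Finset L) (n : ℕ) :
    ∃ p : ℕ, ∃ _ : Fact p.Prime, n < p ∧ ∃ τ : L →+* ℚ_[p], ∀ x ∈ s, ‖τ x‖ ≤ 1 := by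
  classical
  let pb := Field.powerBasisOfFiniteOfSeparable ℚ L
  set m := minpoly ℚ pb.gen with hm
  have hint : IsIntegral ℚ pb.gen := Algebra.IsIntegral.isIntegral _
  have hmd : 0 < m.natDegree := minpoly.natDegree_pos hint
  obtain ⟨a, b, hab⟩ := (minpoly.irreducible hint).separable
  obtain ⟨c, hc, G, hG⟩ := clr m
  obtain ⟨d1, hd1, A, hA⟩ := clr a
  obtain ⟨d2, hd2, B, hB⟩ := clr b
  have hinj : Function.Injective (Polynomial.map (Int.castRingHom ℚ)) :=
    Polynomial.map_injective _ (RingHom.injective_int _)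
  have hD : Polynomial.C d2 * A * G + Polynomial.C d1 * B * Polynomial.derivative G =
      Polynomial.C (d1 * d2 * c) := by
    apply hinj
    simp only [Polynomial.map_add, Polynomial.map_mul, Polynomial.map_C, ← Polynomial.derivative_map,
      hA, hB, hG, Polynomial.derivative_C_mul, map_mul, RingHom.map_mul, Int.coe_castRingHom]
    linear_combination (Polynomial.C (d1 : ℚ) * Polynomial.C (d2:ℚ) * Polynomial.C (c:ℚ)) * hab
  have hGd : 0 < G.natDegree := by
    have := Polynomial.natDegree_map_eq_of_injective (RingHom.injective_int (Int.castRingHom ℚ)) G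
    rw [← this, hG, Polynomial.natDegree_C_mul (by exact_mod_cast hc)]
    exact hmd
  have hx : ∀ x : L, ∃ d : ℤ, d ≠ 0 ∧ ∃ H : Polynomial ℤ, (d : L) * x = Polynomial.aeval pb.gen H := by
    intro x
    obtain ⟨f, hf⟩ := pb.exists_eq_aeval' x
    obtain ⟨d, hd, H, hH⟩ := clr f
    refine ⟨d, hd, H, ?_⟩
    have h1 := congrArg (Polynomial.aeval pb.gen) hH
    rw [map_mul, ← hf, Polynomial.aeval_C] at h1
    rw [show (algebraMap ℚ L) (d : ℚ) = (d : L) from map_intCast _ _] at h1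
    rw [← h1]
    exact Polynomial.aeval_map_algebraMap ℚ pb.gen H
  choose d hd H hH using hx
  obtain ⟨p, hp, hlt, t, ht⟩ := schur G hGd (n + (d1 * d2 * c).natAbs + ∑ x ∈ s, (d x).natAbs)
  haveI : Fact p.Prime := ⟨hp⟩
  have hev : ∀ F : Polynomial ℤ, Polynomial.aeval (t : ℤ_[p]) F = ((F.eval t : ℤ) : ℤ_[p]) := by
    intro F
    have := Polynomial.aeval_algebraMap_apply_eq_algebraMap_eval (A := ℤ_[p]) t F
    simpa using this
  have hn1 : ‖Polynomial.aeval (t : ℤ_[p]) G‖ < 1 := by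
    rw [hev, PadicInt.norm_int_lt_one_iff_dvd]; exact ht
  have hn2 : ‖Polynomial.aeval (t : ℤ_[p]) (Polynomial.derivative G)‖ = 1 := by
    by_contra hne
    have h1 := lt_of_le_of_ne (PadicInt.norm_le_one _) hne
    rw [hev, PadicInt.norm_int_lt_one_iff_dvd] at h1
    have h2 := congrArg (Polynomial.eval t) hD
    rw [Polynomial.eval_add, Polynomial.eval_mul, Polynomial.eval_mul (q := Polynomial.derivative G),
      Polynomial.eval_C] at h2
    have h3 : (p : ℤ) ∣ d1 * d2 * c := h2 ▸ dvd_add (dvd_mul_of_dvd_right ht _) (dvd_mul_of_dvd_right h1 _)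
    have := Nat.le_of_dvd (Int.natAbs_pos.mpr (mul_ne_zero (mul_ne_zero hd1 hd2) hc))
      (Int.natCast_dvd.mp h3)
    omega
  obtain ⟨z, hz, -⟩ := hensels_lemma (F := G) (a := (t : ℤ_[p])) (by rw [hn2]; simpa using hn1)
  have hco : ∀ F : Polynomial ℤ, Polynomial.aeval (z : ℚ_[p]) F = ((Polynomial.aeval z F : ℤ_[p]) : ℚ_[p]) := by
    intro F
    exact Polynomial.aeval_algebraMap_apply ℚ_[p] z F
  have hz' : Polynomial.aeval (z : ℚ_[p]) (minpoly ℚ pb.gen) = 0 := by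
    have h1 := congrArg (Polynomial.aeval (z : ℚ_[p])) hG
    rw [map_mul, Polynomial.aeval_C] at h1
    have h2 : Polynomial.aeval (z : ℚ_[p]) (G.map (Int.castRingHom ℚ)) = 0 := by
      have := Polynomial.aeval_map_algebraMap ℚ (z : ℚ_[p]) G
      rw [hco, hz] at this
      simpa using this
    rw [h2] at h1
    have h3 : (algebraMap ℚ ℚ_[p]) (c : ℚ) ≠ 0 := by
      simpa using hc
    exact (mul_eq_zero.mp h1.symm).resolve_left h3
  refine ⟨p, ‹_›, by omega, (pb.lift (z : ℚ_[p]) hz').toRingHom, ?_⟩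
  intro x hxs
  have h1 := congrArg (pb.lift (z : ℚ_[p]) hz') (hH x)
  rw [map_mul, map_intCast] at h1
  have h2 : (pb.lift (z : ℚ_[p]) hz') (Polynomial.aeval pb.gen (H x)) =
      Polynomial.aeval (z : ℚ_[p]) (H x) := by
    have h0 := (Polynomial.aeval_algHom_apply ((pb.lift (z : ℚ_[p]) hz').restrictScalars ℤ) pb.gen (H x)).symm
    rw [AlgHom.restrictScalars_apply, AlgHom.restrictScalars_apply, pb.lift_gen (z : ℚ_[p]) hz'] at h0
    exact h0
  rw [h2, hco] at h1
  have h3 : (d x).natAbs < p := by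
    have := Finset.single_le_sum (f := fun x => (d x).natAbs) (fun _ _ => Nat.zero_le _) hxs
    omega
  have h4 := norm_one_of (p := p) (d x) (hd x) h3
  have h5 := congrArg norm h1
  rw [norm_mul] at h5
  have h6 : ‖((d x : ℤ) : ℚ_[p])‖ = 1 := by
    rw [← h4, PadicInt.norm_def]; simp
  rw [h6, one_mul] at h5
  show ‖(pb.lift (z : ℚ_[p]) hz') x‖ ≤ 1
  rw [h5]
  exact PadicInt.norm_le_one _

lemma lemC0 (B : Type) [CommRing B] [Nontrivial B] [Algebra ℚ B] [Algebra.FiniteType ℚ B]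
    (T : Finset B) (n : ℕ) :
    ∃ p : ℕ, ∃ _ : Fact p.Prime, n < p ∧ ∃ τ : B →+* ℚ_[p], ∀ x ∈ T, ‖τ x‖ ≤ 1 := by
  classical
  obtain ⟨m, hm⟩ := Ideal.exists_maximal B
  haveI : Algebra.FiniteType ℚ (B ⧸ m) :=
    Algebra.FiniteType.of_surjective (Ideal.Quotient.mkₐ ℚ m) Ideal.Quotient.mk_surjective
  letI : Field (B ⧸ m) := Ideal.Quotient.field m
  haveI : FiniteDimensional ℚ (B ⧸ m) := finite_of_finite_type_of_isJacobsonRing ℚ (B ⧸ m)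
  obtain ⟨p, hp, hn, τ, hτ⟩ := lemB (B ⧸ m) (T.image (Ideal.Quotient.mk m)) n
  exact ⟨p, hp, hn, τ.comp (Ideal.Quotient.mk m), fun x hx => hτ _ (Finset.mem_image_of_mem _ hx)⟩

lemma lemC (K : Type) [Field K] [CharZero K] (s : Finset K) (n : ℕ) :
    ∃ p : ℕ, ∃ _ : Fact p.Prime, n < p ∧
      Nonempty (Algebra.adjoin ℤ (s : Set K) →+* ℤ_[p]) := by
  classical
  let B := Algebra.adjoin ℚ (s : Set K)
  haveI : Algebra.FiniteType ℚ B := (Subalgebra.fg_iff_finiteType _).mp (Subalgebra.fg_adjoin_finset s)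
  obtain ⟨p, hp, hn, ψ, hτ⟩ := lemC0 B
    (s.attach.image fun x : {x // x ∈ s} => (⟨x.1, Algebra.subset_adjoin (Finset.mem_coe.mpr x.2)⟩ : B)) n
  refine ⟨p, hp, hn, ?_⟩
  have hle : ∀ x ∈ Algebra.adjoin ℤ (s : Set K), x ∈ B := by
    intro x hx
    induction hx using Algebra.adjoin_induction with
    | mem x hx => exact Algebra.subset_adjoin hx
    | algebraMap r => exact intCast_mem B r
    | add x y _ _ h1 h2 => exact add_mem h1 h2
    | mul x y _ _ h1 h2 => exact mul_mem h1 h2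
  have hnorm : ∀ x (hx : x ∈ Algebra.adjoin ℤ (s : Set K)), ‖ψ ⟨x, hle x hx⟩‖ ≤ 1 := by
    intro x hx
    induction hx using Algebra.adjoin_induction with
    | mem x hx =>
      apply hτ
      rw [Finset.mem_image]
      exact ⟨⟨x, hx⟩, Finset.mem_attach _ _, rfl⟩
    | algebraMap r =>
      have : (⟨algebraMap ℤ K r, hle _ (Subalgebra.algebraMap_mem _ r)⟩ : B) = (r : B) := by
        apply Subtype.ext; simp
      rw [this, map_intCast]
      exact Padic.norm_int_le_one r
    | add x y hx hy h1 h2 =>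
      have : (⟨x + y, hle _ (add_mem hx hy)⟩ : B) = ⟨x, hle x hx⟩ + ⟨y, hle y hy⟩ := rfl
      rw [this, map_add]
      exact (Padic.nonarchimedean _ _).trans (max_le h1 h2)
    | mul x y hx hy h1 h2 =>
      have : (⟨x * y, hle _ (mul_mem hx hy)⟩ : B) = ⟨x, hle x hx⟩ * ⟨y, hle y hy⟩ := rfl
      rw [this, map_mul, norm_mul]
      exact mul_le_one₀ h1 (norm_nonneg _) h2
  exact ⟨{ toFun := fun x => ⟨ψ ⟨x.1, hle x.1 x.2⟩, hnorm x.1 x.2⟩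
           map_one' := Subtype.ext (map_one ψ)
           map_zero' := Subtype.ext (map_zero ψ)
           map_add' := fun x y => Subtype.ext (map_add ψ ⟨x.1, hle x.1 x.2⟩ ⟨y.1, hle y.1 y.2⟩)
           map_mul' := fun x y => Subtype.ext (map_mul ψ ⟨x.1, hle x.1 x.2⟩ ⟨y.1, hle y.1 y.2⟩) }⟩

end
end WA


namespace WA
section
open MvPolynomial

lemma le_of_deg {R : Type} [CommRing R] {m : M R} {N : ℕ} (h : m.totalDegree ≤ N) (s : Fin 2 →₀ ℕ)
    (hs : coeff s m ≠ 0) : s 0 ≤ N ∧ s 1 ≤ N := by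
  have h1 := le_totalDegree (mem_support_iff.mpr hs)
  rw [Finsupp.sum_fintype _ _ (by simp), Fin.sum_univ_two] at h1
  omega

lemma totalDegree_map_le {R S : Type} [CommRing R] [CommRing S] (φ : R →+* S) (m : M R) :
    (map φ m).totalDegree ≤ m.totalDegree := by
  rw [totalDegree, totalDegree]
  exact Finset.sup_mono (support_map_subset φ m)

lemma totalDegree_map_of_injective {R S : Type} [CommRing R] [CommRing S] {φ : R →+* S} (m : M R)
    (h : Function.Injective φ) : (map φ m).totalDegree = m.totalDegree := by
  rw [totalDegree, totalDegree, support_map_of_injective m h]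

lemma neg_pow_odd {A : Type} [Ring A] (a : A) {n : ℕ} (h : Odd n) : (-a) ^ n = -a ^ n := h.neg_pow a

lemma core_mod (p : ℕ) [Fact p.Prime] (N : ℕ) (hpN : 2 * N + 2 < p) {P Q : Weyl (ZMod (p ^ 2))}
    (h : Q * P = P * Q + 1) (hP : st P = P) (hQ : st Q = -Q)
    (dP : (sym P).totalDegree ≤ N) (dQ : (sym Q).totalDegree ≤ N) :
    (sym (mp (ZMod.castHom (dvd_pow_self p two_ne_zero) (ZMod p)) Q)).totalDegree ≤ 1 := by
  set π := ZMod.castHom (dvd_pow_self p two_ne_zero) (ZMod p) with hπ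
  have hp : p.Prime := Fact.out
  have hodd : Odd p := hp.odd_of_ne_two (by omega)
  have h' : mp π Q * mp π P = mp π P * mp π Q + 1 := by
    rw [← map_mul, h, map_add, map_mul, map_one]
  obtain ⟨c1, c2⟩ := pow_cen p h'
  obtain ⟨Φ, e1⟩ := ex_expand p c1
  obtain ⟨Ψ, e2⟩ := ex_expand p c2
  have hj := jac_one p h e1 e2
  have k1 := deg_expand p _ _ e1
  have k2 := deg_expand p _ _ e2
  have q1 : st (mp π P ^ p) = mp π P ^ p := by rw [st_pow, st_mp, hP]
  have q2 : st (mp π Q ^ p) = - mp π Q ^ p := by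
    rw [st_pow, st_mp, hQ, map_neg, neg_pow_odd _ hodd]
  rw [e1] at q1
  rw [e2] at q2
  have r1 := parity_even p hodd q1
  have r2 := parity_odd p hodd q2
  have dP' : Φ.totalDegree ≤ N := by
    rw [k1, sym_mp]; exact (totalDegree_map_le _ _).trans dP
  have dQ' : Ψ.totalDegree ≤ N := by
    rw [k2, sym_mp]; exact (totalDegree_map_le _ _).trans dQ
  rw [← k2]
  exact comm_lem p N hpN hj
    (fun s hs => ⟨(le_of_deg dP' s hs).1, (le_of_deg dP' s hs).2, r1 s hs⟩)
    (fun s hs => ⟨(le_of_deg dQ' s hs).1, (le_of_deg dQ' s hs).2, r2 s hs⟩)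

lemma ex_lift {K : Type} [Field K] (R : Subalgebra ℤ K) (w : Weyl K)
    (h : ∀ s, coeff s (sym w) ∈ R) : ∃ w' : Weyl R, mp R.val.toRingHom w' = w := by
  have : sym w ∈ Set.range (map (σ := Fin 2) R.val.toRingHom) := by
    rw [mem_range_map_iff_coeffs_subset]
    intro c hc
    obtain ⟨s, _, rfl⟩ := mem_coeffs_iff.mp hc
    exact ⟨⟨_, h s⟩, rfl⟩
  obtain ⟨m, hm⟩ := this
  exact ⟨nf m, by rw [mp_nf, hm, nf_sym]⟩

theorem core {K : Type} [Field K] [CharZero K] {P Q : Weyl K}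
    (h : Q * P = P * Q + 1) (hP : st P = P) (hQ : st Q = -Q) : (sym Q).totalDegree ≤ 1 := by
  classical
  by_contra hcon
  obtain ⟨s0, hs0, hs1⟩ : ∃ s, coeff s (sym Q) ≠ 0 ∧ 1 < s.sum fun _ e => e := by
    by_contra hc
    push Not at hc
    apply hcon
    rw [totalDegree]
    exact Finset.sup_le fun s hs => hc s (mem_support_iff.mp hs)
  set δ := coeff s0 (sym Q) with hδ
  set S : Finset K := insert δ⁻¹ ((sym P).coeffs ∪ (sym Q).coeffs) with hS
  set N := max (sym P).totalDegree (sym Q).totalDegree with hN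
  obtain ⟨p, hp, hpN, ⟨φ⟩⟩ := lemC K S (2 * N + 2)
  set R := Algebra.adjoin ℤ (S : Set K) with hR
  have hmP : ∀ s, coeff s (sym P) ∈ R := by
    intro s
    by_cases hs : coeff s (sym P) = 0
    · rw [hs]; exact zero_mem _
    · apply Algebra.subset_adjoin
      simp only [hS, Finset.coe_insert, Finset.coe_union, Set.mem_insert_iff, Set.mem_union]
      exact Or.inr (Or.inl (coeff_mem_coeffs s hs))
  have hmQ : ∀ s, coeff s (sym Q) ∈ R := by
    intro s
    by_cases hs : coeff s (sym Q) = 0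
    · rw [hs]; exact zero_mem _
    · apply Algebra.subset_adjoin
      simp only [hS, Finset.coe_insert, Finset.coe_union, Set.mem_insert_iff, Set.mem_union]
      exact Or.inr (Or.inr (coeff_mem_coeffs s hs))
  have hmd : δ⁻¹ ∈ R := Algebra.subset_adjoin (by simp [hS])
  obtain ⟨P', hP'⟩ := ex_lift R P hmP
  obtain ⟨Q', hQ'⟩ := ex_lift R Q hmQ
  have hi : Function.Injective R.val.toRingHom := Subtype.val_injective
  have hmi := mp_inj _ hi
  have h' : Q' * P' = P' * Q' + 1 := by
    apply hmi
    rw [map_mul, hQ', hP', h, map_add, map_mul, hQ', hP', map_one]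
  have hsP : st P' = P' := by
    apply hmi; rw [← st_mp, hP', hP]
  have hsQ : st Q' = -Q' := by
    apply hmi; rw [← st_mp, hQ', hQ, map_neg, hQ']
  have dP : (sym P').totalDegree ≤ N := by
    have : (sym P).totalDegree = (sym P').totalDegree := by
      rw [← hP', sym_mp]; exact totalDegree_map_of_injective _ hi
    rw [← this]; exact le_max_left _ _
  have dQ : (sym Q').totalDegree ≤ N := by
    have : (sym Q).totalDegree = (sym Q').totalDegree := by
      rw [← hQ', sym_mp]; exact totalDegree_map_of_injective _ hi
    rw [← this]; exact le_max_right _ _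
  let χ : R →+* ZMod (p ^ 2) := (PadicInt.toZModPow 2).comp φ
  have key := core_mod p N hpN (P := mp χ P') (Q := mp χ Q')
    (by rw [← map_mul, h', map_add, map_mul, map_one]) (by rw [st_mp, hsP])
    (by rw [st_mp, hsQ, map_neg])
    (by rw [sym_mp]; exact (totalDegree_map_le _ _).trans dP)
    (by rw [sym_mp]; exact (totalDegree_map_le _ _).trans dQ)
  set π := ZMod.castHom (dvd_pow_self p two_ne_zero) (ZMod p)
  rw [sym_mp, sym_mp] at key
  have hc : coeff s0 (map π (map χ (sym Q'))) ≠ 0 := by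
    rw [coeff_map, coeff_map]
    have hu : IsUnit (coeff s0 (sym Q')) := by
      refine IsUnit.of_mul_eq_one ⟨δ⁻¹, hmd⟩ (Subtype.ext ?_)
      have e : ((coeff s0 (sym Q') : R) : K) = δ := by
        rw [hδ, ← hQ', sym_mp, coeff_map]; rfl
      show ((coeff s0 (sym Q') : R) : K) * δ⁻¹ = 1
      rw [e]; exact mul_inv_cancel₀ hs0
    exact ((hu.map χ).map π).ne_zero
  have := le_totalDegree (mem_support_iff.mpr hc)
  omega

end
end WA


namespace WA
section
open MvPolynomial

variable {K : Type} [Field K] [CharZero K]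

lemma end_inj (F : Weyl K →ₐ[K] Weyl K) : Function.Injective F := by
  rw [injective_iff_map_eq_zero]
  intro w hw
  refine inj_aux (FaithfulSMul.algebraMap_injective K (Weyl K)) F ((sym w).totalDegree + 1)
    (fun m hm _ => by exact_mod_cast hm.ne') _ w le_rfl (fun s hs => ?_) hw
  have := le_of_deg le_rfl s hs
  omega

lemma mem_of_sym (A : Subalgebra K (Weyl K)) (w : Weyl K)
    (h : ∀ s, coeff s (sym w) ≠ 0 → Wx K ^ s 0 * Wy K ^ s 1 ∈ A) : w ∈ A := by
  rw [← nf_sym w, (sym w).as_sum, map_sum]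
  refine sum_mem fun s hs => ?_
  rw [nf_mon]
  exact A.smul_mem (h s (mem_support_iff.mp hs)) _

lemma zero_of_pd {m : M K} {i : Fin 2} (h : pderiv i m = 0) (s : Fin 2 →₀ ℕ) (hs : coeff s m ≠ 0) :
    s i = 0 := by
  by_contra hi
  have h1 := congrArg (fun q => coeff s (X i * q)) h
  simp only [coeff_euler, mul_zero, coeff_zero] at h1
  rcases mul_eq_zero.mp h1 with h2 | h2
  · exact hi (by exact_mod_cast h2)
  · exact hs h2

lemma cen_y {w : Weyl K} (h : Wy K * w = w * Wy K) : w ∈ Algebra.adjoin K {Wy K} := by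
  have h0 : pderiv 0 (sym w) = 0 := by rw [← sym_ady, h, sub_self, map_zero]
  refine mem_of_sym _ _ fun s hs => ?_
  rw [zero_of_pd h0 s hs, pow_zero, one_mul]
  exact pow_mem (Algebra.subset_adjoin (Set.mem_singleton _)) _

lemma cen_x {w : Weyl K} (h : w * Wx K = Wx K * w) : w ∈ Algebra.adjoin K {Wx K} := by
  have h0 : pderiv 1 (sym w) = 0 := by rw [← sym_adx, h, sub_self, map_zero]
  refine mem_of_sym _ _ fun s hs => ?_
  rw [zero_of_pd h0 s hs, pow_zero, mul_one]
  exact pow_mem (Algebra.subset_adjoin (Set.mem_singleton _)) _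

lemma cen_P {P Q w : Weyl K} (h : Q * P = P * Q + 1) (hg : Algebra.adjoin K {P, Q} = ⊤)
    (hw : w * P = P * w) : w ∈ Algebra.adjoin K {P} := by
  set φ := lft (R := K) P Q h with hφ
  have hs : φ.range = ⊤ := by
    rw [eq_top_iff, ← hg, Algebra.adjoin_le_iff]
    rintro z (rfl | rfl)
    · exact ⟨Wx K, lft_x _ _ _⟩
    · exact ⟨Wy K, lft_y _ _ _⟩
  obtain ⟨v, rfl⟩ : w ∈ φ.range := hs ▸ Algebra.mem_top
  have hv : v * Wx K = Wx K * v := by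
    apply end_inj φ
    rw [map_mul, map_mul, hφ, lft_x]; exact hw
  have h1 : φ v ∈ (Algebra.adjoin K {Wx K}).map φ := ⟨v, cen_x hv, rfl⟩
  rw [AlgHom.map_adjoin, Set.image_singleton, hφ, lft_x] at h1
  exact h1

section abstr
variable {A : Type} [Ring A] [Algebra K A]

lemma swap_rel {P Q : A} (h : Q * P = P * Q + 1) : (-P) * Q = Q * (-P) + 1 := by
  rw [neg_mul, mul_neg, h]; abel

lemma half1 {P Q Q2 : A} (h : Q * P = P * Q + 1) (h2 : P * Q2 = Q2 * P + 1) :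
    ((2 : K)⁻¹ • (Q - Q2)) * P = P * ((2 : K)⁻¹ • (Q - Q2)) + 1 := by
  have h3 : (2 : K)⁻¹ • (1 + 1 : A) = 1 := by
    rw [← two_smul K, smul_smul, inv_mul_cancel₀ two_ne_zero, one_smul]
  rw [smul_mul_assoc, mul_smul_comm, sub_mul, mul_sub, h, h2]
  refine Eq.trans ?_ (congrArg (_ + ·) h3)
  show _ = _ • _ + _ • _
  rw [← smul_add]
  congr 1
  abel

lemma half2 {P Q P2 : A} (h : Q * P = P * Q + 1) (h2 : Q * P2 = P2 * Q + 1) :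
    Q * ((2 : K)⁻¹ • (P + P2)) = ((2 : K)⁻¹ • (P + P2)) * Q + 1 := by
  have h3 : (2 : K)⁻¹ • (1 + 1 : A) = 1 := by
    rw [← two_smul K, smul_smul, inv_mul_cancel₀ two_ne_zero, one_smul]
  rw [smul_mul_assoc, mul_smul_comm, add_mul, mul_add, h, h2]
  conv_rhs => rw [← h3, ← smul_add]
  congr 1
  abel

lemma comm_diff {P Q Q' : A} (h : Q * P = P * Q + 1) (h2 : Q' * P = P * Q' + 1) :
    (Q - Q') * P = P * (Q - Q') := by
  rw [sub_mul, mul_sub, h, h2]; abel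

lemma comm_diff2 {P Q P' : A} (h : Q * P = P * Q + 1) (h2 : Q * P' = P' * Q + 1) :
    (P - P') * Q = Q * (P - P') := by
  rw [sub_mul, mul_sub, h, h2]; abel

lemma gen_of {P Q Q' : A} (hg : Algebra.adjoin K {P, Q'} = ⊤) (h : Q - Q' ∈ Algebra.adjoin K {P}) :
    Algebra.adjoin K {P, Q} = ⊤ := by
  have hP : P ∈ Algebra.adjoin K {P, Q} := Algebra.subset_adjoin (by simp)
  have hQ : Q ∈ Algebra.adjoin K {P, Q} := Algebra.subset_adjoin (by simp)
  have hd : Q - Q' ∈ Algebra.adjoin K {P, Q} :=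
    Algebra.adjoin_mono (by simp) h
  rw [eq_top_iff, ← hg, Algebra.adjoin_le_iff]
  rintro z (rfl | rfl)
  · exact hP
  · have := sub_mem hQ hd
    rwa [sub_sub_cancel] at this

lemma gen_neg {P Q : A} (hg : Algebra.adjoin K {Q, -P} = ⊤) : Algebra.adjoin K {P, Q} = ⊤ := by
  rw [eq_top_iff, ← hg, Algebra.adjoin_le_iff]
  rintro z (rfl | rfl)
  · exact Algebra.subset_adjoin (by simp)
  · exact neg_mem (Algebra.subset_adjoin (by simp))

lemma neg_half (c : K) (a b : A) : c • (b - a) = -(c • (a - b)) := by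
  rw [← smul_neg, neg_sub]

lemma neg_rel {S Q : A} (h : S * (-Q) = (-Q) * S + 1) : Q * S = S * Q + 1 := by
  rw [mul_neg, neg_mul] at h
  have h1 : Q * S = -(-(Q * S) + 1) + 1 := by abel
  rw [h1, ← h, neg_neg]

lemma gen_neg2 {P Q : A} (hg : Algebra.adjoin K {Q, P} = ⊤) : Algebra.adjoin K {Q, -P} = ⊤ := by
  rw [eq_top_iff, ← hg, Algebra.adjoin_le_iff]
  rintro z (rfl | rfl)
  · exact Algebra.subset_adjoin (by simp)
  · have : -z ∈ Algebra.adjoin K {Q, -z} := Algebra.subset_adjoin (by simp)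
    simpa using neg_mem this

lemma rel_scale {P Q y : A} {c : K} (hQ : Q = c • y) (h : Q * P = P * Q + 1) :
    y * (c • P) = (c • P) * y + 1 := by
  rw [hQ, smul_mul_assoc, mul_smul_comm] at h
  rw [mul_smul_comm, smul_mul_assoc, h]

lemma eq_zero_of_neg {B : Type} [AddCommGroup B] [Module K B] {a : B} (h : a = -a) : a = 0 := by
  have h1 : (2 : K) • a = 0 := by rw [two_smul]; nth_rewrite 1 [h]; simp
  exact (smul_eq_zero.mp h1).resolve_left two_ne_zero

end abstr

lemma lin_form {Q : Weyl K} (hd : (sym Q).totalDegree ≤ 1) (hQ : st Q = -Q) : ∃ c : K, Q = c • Wy K := by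
  have hcase : ∀ s, coeff s (sym Q) ≠ 0 → s 0 + s 1 ≤ 1 := by
    intro s hs
    have h1 := le_totalDegree (mem_support_iff.mpr hs)
    rw [Finsupp.sum_fintype _ _ (by simp), Fin.sum_univ_two] at h1
    omega
  have hform : ∃ a b c : K, Q = a • 1 + b • Wx K + c • Wy K := by
    rw [← nf_sym Q, (sym Q).as_sum, map_sum]
    apply Finset.sum_induction (p := fun w : Weyl K => ∃ a b c : K, w = a • 1 + b • Wx K + c • Wy K)
    · rintro _ _ ⟨a, b, c, rfl⟩ ⟨a', b', c', rfl⟩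
      exact ⟨a + a', b + b', c + c', by simp only [add_smul]; abel⟩
    · exact ⟨0, 0, 0, by simp⟩
    · intro s hs
      have := hcase s (mem_support_iff.mp hs)
      rw [nf_mon]
      set r := coeff s (sym Q)
      rcases (by omega : (s 0 = 0 ∧ s 1 = 0) ∨ (s 0 = 1 ∧ s 1 = 0) ∨ (s 0 = 0 ∧ s 1 = 1)) with
        ⟨h0, h1⟩ | ⟨h0, h1⟩ | ⟨h0, h1⟩
      · exact ⟨r, 0, 0, by rw [h0, h1]; simp⟩
      · exact ⟨0, r, 0, by rw [h0, h1]; simp⟩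
      · exact ⟨0, 0, r, by rw [h0, h1]; simp⟩
  obtain ⟨a, b, c, rfl⟩ := hform
  refine ⟨c, ?_⟩
  rw [st_add, st_add, st_smul, st_smul, st_smul, st_one, st_x, st_y] at hQ
  have h1 : a • (1 : Weyl K) + b • Wx K = -(a • (1 : Weyl K) + b • Wx K) := by
    rw [smul_neg, neg_add] at hQ
    exact add_right_cancel hQ
  rw [eq_zero_of_neg (K := K) h1, zero_add]

lemma core2 {P Q : Weyl K} (h : Q * P = P * Q + 1) (hP : st P = P) (hQ : st Q = -Q) :
    Algebra.adjoin K {P, Q} = ⊤ := by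
  obtain ⟨c, hc⟩ := lin_form (core h hP hQ) hQ
  have hc0 : c ≠ 0 := by
    rintro rfl
    rw [zero_smul] at hc
    rw [hc, zero_mul, mul_zero, zero_add] at h
    exact zero_ne_one h
  have h1 := comm_diff2 (rel_scale hc h) (yx (R := K))
  have h2 := cen_y h1.symm
  have hPm : P ∈ Algebra.adjoin K {P, Q} := Algebra.subset_adjoin (by simp)
  have hQm : Q ∈ Algebra.adjoin K {P, Q} := Algebra.subset_adjoin (by simp)
  have hy : Wy K ∈ Algebra.adjoin K {P, Q} := by
    have : Wy K = c⁻¹ • Q := by rw [hc, smul_smul, inv_mul_cancel₀ hc0, one_smul]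
    rw [this]; exact Subalgebra.smul_mem _ hQm _
  have hd : c • P - Wx K ∈ Algebra.adjoin K {P, Q} := by
    refine (Algebra.adjoin_le_iff.mpr ?_) h2
    rintro z rfl; exact hy
  have hx : Wx K ∈ Algebra.adjoin K {P, Q} := by
    have := sub_mem (Subalgebra.smul_mem _ hPm c) hd
    rwa [sub_sub_cancel] at this
  rw [eq_top_iff, ← adj, Algebra.adjoin_le_iff]
  rintro z (rfl | rfl)
  · exact hx
  · exact hy

lemma G1 {P Q : Weyl K} (h : Q * P = P * Q + 1) (hP : st P = P) : Algebra.adjoin K {P, Q} = ⊤ := by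
  have h2 : P * st Q = st Q * P + 1 := by
    have := congrArg st h
    rwa [st_mul, st_add, st_mul, st_one, hP] at this
  have h3 := half1 (K := K) h h2
  have hs : st ((2 : K)⁻¹ • (Q - st Q)) = -((2 : K)⁻¹ • (Q - st Q)) := by
    rw [st_smul, st_sub, st_st]; exact neg_half _ _ _
  have h4 := core2 h3 hP hs
  exact gen_of h4 (cen_P h3 h4 (comm_diff h h3))

lemma G2 {P Q : Weyl K} (h : Q * P = P * Q + 1) (hQ : st Q = -Q) : Algebra.adjoin K {P, Q} = ⊤ := by
  have h2 : Q * st P = st P * Q + 1 := by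
    have := congrArg st h
    rw [st_mul, st_add, st_mul, st_one, hQ] at this
    exact neg_rel this
  have h3 := half2 (K := K) h h2
  have hs : st ((2 : K)⁻¹ • (P + st P)) = ((2 : K)⁻¹ • (P + st P)) := by
    rw [st_smul, st_add, st_st, add_comm]
  have h4 := core2 h3 hs hQ
  rw [Set.pair_comm]
  rw [Set.pair_comm] at h4
  refine gen_of h4 ?_
  have h6 : Algebra.adjoin K {Q, -((2 : K)⁻¹ • (P + st P))} = ⊤ := by
    exact gen_neg2 h4
  exact cen_P (swap_rel h3) h6 (comm_diff2 h h3)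


lemma G0 {P Q : Weyl K} (h : Q * P = P * Q + 1)
    (hs : st P = P ∨ st P = -P ∨ st Q = Q ∨ st Q = -Q) : Algebra.adjoin K {P, Q} = ⊤ := by
  rcases hs with hs | hs | hs | hs
  · exact G1 h hs
  · exact gen_neg (G2 (swap_rel h) (by rw [st_neg, hs]))
  · exact gen_neg (G1 (swap_rel h) hs)
  · exact G2 h hs

lemma surj_of {H : Weyl K → Weyl K} (hH : IsAlgEndo K H ∨ IsAntiEndo K H)
    (hg : Algebra.adjoin K {H (Wx K), H (Wy K)} = ⊤) : Function.Surjective H := by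
  have hadd : ∀ a b, H (a + b) = H a + H b := by rcases hH with h | h <;> exact h.1
  have hsm : ∀ (c : K) a, H (c • a) = c • H a := by rcases hH with h | h <;> exact h.2.1
  have hone : H 1 = 1 := by rcases hH with h | h <;> exact h.2.2.2
  intro w
  have hw : w ∈ Algebra.adjoin K {H (Wx K), H (Wy K)} := hg ▸ Algebra.mem_top
  induction hw using Algebra.adjoin_induction with
  | mem x hx =>
    rcases hx with rfl | rfl
    · exact ⟨_, rfl⟩
    · exact ⟨_, rfl⟩
  | algebraMap r => exact ⟨r • 1, by rw [hsm, hone, Algebra.algebraMap_eq_smul_one]⟩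
  | add x y _ _ h1 h2 =>
    obtain ⟨a, rfl⟩ := h1
    obtain ⟨b, rfl⟩ := h2
    exact ⟨a + b, hadd a b⟩
  | mul x y _ _ h1 h2 =>
    obtain ⟨a, rfl⟩ := h1
    obtain ⟨b, rfl⟩ := h2
    rcases hH with h | h
    · exact ⟨a * b, h.2.2.1 a b⟩
    · exact ⟨b * a, h.2.2.1 b a⟩

lemma toHom {f : Weyl K → Weyl K} (hf : IsAlgEndo K f) :
    ∃ F : Weyl K →ₐ[K] Weyl K, ∀ w, F w = f w :=
  ⟨AlgHom.ofLinearMap { toFun := f, map_add' := hf.1, map_smul' := hf.2.1 } hf.2.2.2 hf.2.2.1,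
    fun _ => rfl⟩

lemma neg_smul_one {A : Type} [Ring A] [Algebra K A] (a : A) : (-1 : K) • a = -a := by
  rw [neg_smul, one_smul]

lemma f_neg {f : Weyl K → Weyl K} (hf : ∀ (c : K) (a : Weyl K), f (c • a) = c • f a) (a : Weyl K) :
    f (-a) = - f a := by
  have := hf (-1) a
  have e : ∀ b : Weyl K, (-1 : K) • b = -b := fun b => neg_smul_one b
  exact ((congrArg f (e a)).symm.trans this).trans (e _)

lemma eta_rel {A : Type} [Ring A] [Algebra K A] {x y : A} (h : y * x = x * y + 1) :
    ((2 : K)⁻¹ • x + y) * ((2 : K)⁻¹ • x - y) = ((2 : K)⁻¹ • x - y) * ((2 : K)⁻¹ • x + y) + 1 := by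
  have h3 : (2 : K)⁻¹ • (1 + 1 : A) = 1 := by
    rw [← two_smul K, smul_smul, inv_mul_cancel₀ two_ne_zero, one_smul]
  have h4 : (2 : K)⁻¹ • (y * x) = (2 : K)⁻¹ • (x * y) + (2 : K)⁻¹ • (1 : A) := by
    rw [h, smul_add]
  simp only [add_mul, mul_add, sub_mul, mul_sub, smul_mul_assoc, mul_smul_comm, smul_add, smul_sub]
  rw [h4]
  refine Eq.trans ?_ (congrArg (_ + ·) h3)
  simp only [smul_add]
  abel

theorem main (α f : Weyl K → Weyl K) (hα : IsExchange K α) (hf : IsAlgEndo K f)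
    (E : Weyl K → Weyl K) (hEα : ConjToAlpha K α E)
    (hsym : E (f (Wx K)) = f (Wx K) ∨ E (f (Wx K)) = -f (Wx K) ∨
            E (f (Wy K)) = f (Wy K) ∨ E (f (Wy K)) = -f (Wy K)) :
    IsAlgAuto K f := by
  obtain ⟨F, hF⟩ := toHom hf
  have finj : Function.Injective f := by
    have : (F : Weyl K → Weyl K) = f := funext hF
    rw [← this]; exact end_inj F
  refine ⟨hf, finj, ?_⟩
  obtain ⟨g, hg, rfl⟩ := hEα
  set η := lft (R := K) ((2 : K)⁻¹ • Wx K - Wy K) ((2 : K)⁻¹ • Wx K + Wy K) (eta_rel yx) with hη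
  have ηinj := end_inj η
  obtain ⟨⟨⟨aadd, asm, amul, aone⟩, -⟩, -⟩ := hα.1
  have hηα : ∀ w, η (α w) = st (η w) := by
    intro w
    induction w using ind with
    | hx =>
      rw [hα.2.1, hη, lft_x, lft_y, st_sub, st_smul, st_x, st_y, sub_neg_eq_add]
    | hy =>
      rw [hα.2.2, hη, lft_x, lft_y, st_add, st_smul, st_x, st_y, ← sub_eq_add_neg]
    | hc r => rw [Algebra.algebraMap_eq_smul_one, asm, aone, map_smul, map_one, st_smul, st_one]
    | ha a b h1 h2 => rw [aadd, map_add, map_add, st_add, h1, h2]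
    | hm a b h1 h2 => rw [amul, map_mul, map_mul, st_mul, h1, h2]
  have gbij : Function.Bijective g := by rcases hg with h | h <;> exact h.2
  have gsm : ∀ (c : K) a, g (c • a) = c • g a := by rcases hg with h | h <;> exact h.1.2.1
  have gadd : ∀ a b, g (a + b) = g a + g b := by rcases hg with h | h <;> exact h.1.1
  have gone : g 1 = 1 := by rcases hg with h | h <;> exact h.1.2.2.2
  have key1 : ∀ w, (Function.invFun g ∘ α ∘ g) w = w → st (η (g w)) = η (g w) := by
    intro w hw
    have h1 := congrArg g hw
    simp only [Function.comp_apply] at h1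
    rw [Function.rightInverse_invFun gbij.2] at h1
    rw [← hηα, h1]
  have key2 : ∀ w, (Function.invFun g ∘ α ∘ g) w = -w → st (η (g w)) = -η (g w) := by
    intro w hw
    have h1 := congrArg g hw
    simp only [Function.comp_apply] at h1
    rw [Function.rightInverse_invFun gbij.2, f_neg gsm] at h1
    rw [← hηα, h1, map_neg]
  have hs : st (η (g (f (Wx K)))) = η (g (f (Wx K))) ∨ st (η (g (f (Wx K)))) = -η (g (f (Wx K))) ∨
      st (η (g (f (Wy K)))) = η (g (f (Wy K))) ∨ st (η (g (f (Wy K)))) = -η (g (f (Wy K))) :=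
    hsym.imp (key1 _) (Or.imp (key2 _) (Or.imp (key1 _) (key2 _)))
  have hrel : f (Wy K) * f (Wx K) = f (Wx K) * f (Wy K) + 1 := by
    rw [← hf.2.2.1, yx, hf.1, hf.2.2.1, hf.2.2.2]
  have hH : IsAlgEndo K (fun w => η (g (f w))) ∨ IsAntiEndo K (fun w => η (g (f w))) := by
    refine hg.imp (fun h => ?_) (fun h => ?_)
    · exact ⟨fun a b => by beta_reduce; rw [hf.1, gadd, map_add], fun c a => by beta_reduce; rw [hf.2.1, gsm, map_smul],
        fun a b => by beta_reduce; rw [hf.2.2.1, h.1.2.2.1, map_mul], by beta_reduce; rw [hf.2.2.2, gone, map_one]⟩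
    · exact ⟨fun a b => by beta_reduce; rw [hf.1, gadd, map_add], fun c a => by beta_reduce; rw [hf.2.1, gsm, map_smul],
        fun a b => by beta_reduce; rw [hf.2.2.1, h.1.2.2.1, map_mul], by beta_reduce; rw [hf.2.2.2, gone, map_one]⟩
  have hgen : Algebra.adjoin K {η (g (f (Wx K))), η (g (f (Wy K)))} = ⊤ := by
    have hr := congrArg (fun w => η (g w)) hrel
    simp only [gadd, gone, map_add, map_one] at hr
    rcases hg with h | h
    · rw [h.1.2.2.1, h.1.2.2.1, map_mul, map_mul] at hr
      exact G0 hr hs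
    · rw [h.1.2.2.1, h.1.2.2.1, map_mul, map_mul] at hr
      rw [Set.pair_comm]
      exact G0 hr (by tauto)
  have hsur := surj_of hH hgen
  intro w
  obtain ⟨v, hv⟩ := hsur (η (g w))
  exact ⟨v, gbij.1 (ηinj hv)⟩

end
end WA

/-- if `P = f X` or `Q = f Y` is symmetric or skew-symmetric with respect
to some involution `E` on `A₁` conjugate to `α`, then `f` is an automorphism. -/
theorem stmt_14 {K : Type} [Field K] [CharZero K]
    (α f : Weyl K → Weyl K) (hα : IsExchange K α) (hf : IsAlgEndo K f)
    (E : Weyl K → Weyl K) (hE : IsInvolutionOn K E) (hEα : ConjToAlpha K α E)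
    (hsym : E (f (Wx K)) = f (Wx K) ∨ E (f (Wx K)) = -f (Wx K) ∨
            E (f (Wy K)) = f (Wy K) ∨ E (f (Wy K)) = -f (Wy K)) :
    IsAlgAuto K f := by
  exact WA.main α f hα hf E hEα hsym
end
end

section
/- Assume Hypothesis (B): every involution on A₁ is conjugate to α. Let f be an endomorphism of A₁ with P = f(X), and let ε ∈ {1, −1}. Then the following are equivalent: (1) there exists an involution E on A₁ with E(P) = εP; (2) there exists g, an automorphism or anti-automorphism of A₁, with α(g(P)) = ε g(P). -/
noncomputable section

/-- assuming every involution on `A₁` is conjugate to `α`, and `ε ∈ {1,-1}`: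
`P = f X` is `ε`-symmetric for some involution `E` iff `g P` is `ε`-symmetric for `α`,
for some automorphism or anti-automorphism `g` of `A₁`. -/
theorem stmt_15 {K : Type} [Field K] [CharZero K]
    (α : Weyl K → Weyl K) (hα : IsExchange K α)
    (hB : ∀ γ : Weyl K → Weyl K, IsInvolutionOn K γ → ConjToAlpha K α γ)
    (f : Weyl K → Weyl K) (hf : IsAlgEndo K f)
    (ε : K) (hε : ε = 1 ∨ ε = -1) :
    (∃ E : Weyl K → Weyl K, IsInvolutionOn K E ∧ E (f (Wx K)) = ε • f (Wx K)) ↔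
    (∃ g : Weyl K → Weyl K, (IsAlgAuto K g ∨ IsAntiAuto K g) ∧
      α (g (f (Wx K))) = ε • g (f (Wx K))) := by
  constructor
  · rintro ⟨E, hE, hP⟩
    obtain ⟨g, hg, hEg⟩ := hB E hE
    refine ⟨g, hg, ?_⟩
    have hbij : Function.Bijective g := hg.elim (fun h => h.2) (fun h => h.2)
    have hsm : ∀ (c : K) (a : Weyl K), g (c • a) = c • g a :=
      hg.elim (fun h => h.1.2.1) (fun h => h.1.2.1)
    have h1 : g (E (f (Wx K))) = α (g (f (Wx K))) := by
      rw [hEg]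
      exact Function.rightInverse_invFun hbij.2 _
    rw [← h1, hP, hsm]
  · rintro ⟨g, hg, hP⟩
    have hbij : Function.Bijective g := hg.elim (fun h => h.2) (fun h => h.2)
    have hsm : ∀ (c : K) (a : Weyl K), g (c • a) = c • g a :=
      hg.elim (fun h => h.1.2.1) (fun h => h.1.2.1)
    have hadd : ∀ (a b : Weyl K), g (a + b) = g a + g b :=
      hg.elim (fun h => h.1.1) (fun h => h.1.1)
    have hone : g 1 = 1 :=
      hg.elim (fun h => h.1.2.2.2) (fun h => h.1.2.2.2)
    obtain ⟨⟨⟨⟨aadd, asm, amul, aone⟩, abij⟩, ainv⟩, -, -⟩ := hα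
    have aa : ∀ x, α (α x) = x := fun x => congrFun ainv x
    have key : ∀ y, g (Function.invFun g y) = y := fun y =>
      Function.rightInverse_invFun hbij.2 _
    have hinv : (fun x => Function.invFun g (α (g x))) ∘
        (fun x => Function.invFun g (α (g x))) = id := by
      funext x
      apply hbij.1
      simp only [Function.comp, key, aa, id]
    refine ⟨fun x => Function.invFun g (α (g x)), ⟨⟨⟨?_, ?_, ?_, ?_⟩, ?_⟩, hinv⟩, ?_⟩
    · intro a b
      apply hbij.1
      simp only [hadd, key, aadd]
    · intro c a
      apply hbij.1
      simp only [hsm, key, asm]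
    · intro a b
      apply hbij.1
      rcases hg with h | h
      · have hm := h.1.2.2.1
        simp only [key, hm, amul]
      · have hm := h.1.2.2.1
        simp only [key, hm, amul]
    · apply hbij.1
      simp only [key, hone, aone]
    · exact (Function.Involutive.bijective (fun x => congrFun hinv x))
    · apply hbij.1
      simp only [key, hsm, hP]
end
end
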